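/- For every positive integer k ≥ 1, there is an L(PV)-formula φ(x) (indeed a PV function symbol) defining a language L in P such that the theory PV ∪ True_0 does not prove the sentence UB^k_io(φ). In other words, it is consistent with PV ∪ True_0 that P is not contained in i.o.SIZE[n^k]. -/

import Mathlib

open FirstOrder FirstOrder.Language

namespace CLB

/-! ### Binary length of a natural number (viewing numbers as binary strings). -/
def len (x : ℕ) : ℕ := Nat.size x

/-! ### Boolean circuits.
A circuit is a straight-line program: a list of gates, each gate a natural number
encoding (via pairing) its type (constant / input / not / and / or) and the indices
of its argument wires (earlier gates).  The size of a circuit is its number of gates. -/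

def gateEval (x : ℕ → Bool) (prev : List Bool) (g : ℕ) : Bool :=
  let t := g.unpair.1 % 5
  let a := g.unpair.2
  if t = 0 then a % 2 == 1
  else if t = 1 then x (a % (prev.length + 1))
  else if t = 2 then !(prev.getD a false)
  else if t = 3 then (prev.getD a.unpair.1 false) && (prev.getD a.unpair.2 false)
  else (prev.getD a.unpair.1 false) || (prev.getD a.unpair.2 false)

def circEvalList (C : List ℕ) (x : ℕ → Bool) : List Bool :=
  C.foldl (fun prev g => prev ++ [gateEval x prev g]) []

/-- The output of a circuit (the value of its last gate). -/
def circEval (C : List ℕ) (x : ℕ → Bool) : Bool := (circEvalList C x).getLastD false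

/-- Parsing a self-delimiting binary representation of a natural number. -/
def parseNum : List Bool → ℕ → ℕ × List Bool
  | [], acc => (acc, [])
  | [_], acc => (acc, [])
  | b :: c :: rest, acc => if b then parseNum rest (2 * acc + (cond c 1 0)) else (acc, rest)

def decodeLN : ℕ → List Bool → List ℕ
  | 0, _ => []
  | _ + 1, [] => []
  | f + 1, l => (parseNum l 0).1 :: decodeLN f (parseNum l 0).2

/-- Decoding a natural number (binary string) as a circuit. -/
def cDecode (x : ℕ) : List ℕ := decodeLN x.bits.length x.bits

/-- The number of gates of the circuit encoded by `x`. -/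
def csize (x : ℕ) : ℕ := (cDecode x).length

/-- Evaluation of an encoded circuit on the bits of an input string: `C(x)`. -/
def cEval (c x : ℕ) : ℕ := cond (circEval (cDecode c) x.testBit) 1 0

/-- `L` has a circuit with at most `s` gates deciding its length-`n` slice. -/
def HasCircAt (L : Set ℕ) (n s : ℕ) : Prop :=
  ∃ C : List ℕ, C.length ≤ s ∧ ∀ x : ℕ, len x = n → (circEval C x.testBit = true ↔ x ∈ L)

/-- `SIZE[s]`: circuits of size `s(n)` on every sufficiently large input length. -/
def SIZEae (s : ℕ → ℕ) : Set (Set ℕ) := {L | ∃ n₀, ∀ n ≥ n₀, HasCircAt L n (s n)}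

/-- `i.o.SIZE[s]`: circuits of size `s(n)` on infinitely many input lengths. -/
def ioSIZE (s : ℕ → ℕ) : Set (Set ℕ) := {L | ∀ n₀, ∃ n ≥ n₀, HasCircAt L n (s n)}

/-- `SIZE[poly]`. -/
def SIZEpoly : Set (Set ℕ) := {L | ∃ c, L ∈ SIZEae (fun n => n ^ c + c)}

/-! ### Polynomial-time functions.
Following Cobham's machine-independent characterization of the polynomial-time
functions (the characterization on which Cook's theory `PV` is based), `PTF` is the
smallest class of functions `ℕ → ℕ` (binary strings, paired via `Nat.pair`) containing
a stock of basic polynomial-time functions and closed under composition, pairing and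
limited recursion on notation. -/

/-- Limited recursion on notation (the recursive call is on the string with its last
bit removed, and the result is truncated by the bounding function `b`). -/
def limRonF (g h b : ℕ → ℕ) (x : ℕ) : ℕ → ℕ
  | 0 => g x
  | y + 1 =>
      min (h (Nat.pair x (Nat.pair (y + 1) (limRonF g h b x ((y + 1) / 2)))))
        (b (Nat.pair x (y + 1)))
  termination_by y => y
  decreasing_by exact Nat.div_lt_self (Nat.succ_pos y) one_lt_two

/-- The class of polynomial-time computable functions (Cobham-style algebra). -/
inductive PTF : (ℕ → ℕ) → Prop
  | id' : PTF (fun z => z)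
  | const (c : ℕ) : PTF (fun _ => c)
  | up1 : PTF (fun z => z.unpair.1)
  | up2 : PTF (fun z => z.unpair.2)
  | lenB : PTF (fun z => len z)
  | add : PTF (fun z => z.unpair.1 + z.unpair.2)
  | sub : PTF (fun z => z.unpair.1 - z.unpair.2)
  | mul : PTF (fun z => z.unpair.1 * z.unpair.2)
  | div : PTF (fun z => z.unpair.1 / z.unpair.2)
  | mod : PTF (fun z => z.unpair.1 % z.unpair.2)
  | smash : PTF (fun z => 2 ^ (len z.unpair.1 * len z.unpair.2))
  | unaryPow (c : ℕ) : PTF (fun z => 2 ^ (len z ^ c))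
  | powc (c : ℕ) : PTF (fun z => z ^ c)
  | ite0 : PTF (fun z => if z.unpair.1 = 0 then z.unpair.2.unpair.1 else z.unpair.2.unpair.2)
  | csizeB : PTF (fun z => csize z)
  | cEvalB : PTF (fun z => cEval z.unpair.1 z.unpair.2)
  | evalnB : PTF (fun z =>
      (Nat.Partrec.Code.evaln (len z.unpair.1)
        (Denumerable.ofNat Nat.Partrec.Code z.unpair.2.unpair.1) z.unpair.2.unpair.2).getD 0)
  | comp {f g} : PTF f → PTF g → PTF (fun z => f (g z))
  | pairF {f g} : PTF f → PTF g → PTF (fun z => Nat.pair (f z) (g z))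
  | limRon {g h b} : PTF g → PTF h → PTF b →
      PTF (fun z => limRonF g h b z.unpair.1 z.unpair.2)

theorem PTF.comp2 {F : ℕ → ℕ → ℕ} (hF : PTF (fun z => F z.unpair.1 z.unpair.2))
    {g h : ℕ → ℕ} (hg : PTF g) (hh : PTF h) : PTF (fun z => F (g z) (h z)) := by
  have := hF.comp (hg.pairF hh)
  simpa using this

/-! ### Complexity classes (over the standard model). -/

/-- `P`: polynomial-time decidable languages. -/
def Pclass : Set (Set ℕ) := {L | ∃ f, PTF f ∧ ∀ x, x ∈ L ↔ f x = 1}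

/-- `NP`: languages with polynomial-time verifiable, polynomially short witnesses. -/
def NPclass : Set (Set ℕ) :=
  {L | ∃ (c : ℕ) (V : ℕ → ℕ), PTF V ∧
    ∀ x, x ∈ L ↔ ∃ y, len y ≤ len x ^ c + c ∧ V (Nat.pair x y) = 1}

/-- Polynomial-time many-one reducibility. -/
def PolyReducible (A B : Set ℕ) : Prop := ∃ f, PTF f ∧ ∀ x, x ∈ A ↔ f x ∈ B

/-- `NP`-completeness (w.r.t. polynomial-time many-one reductions). -/
def NPComplete (O : Set ℕ) : Prop := O ∈ NPclass ∧ ∀ L ∈ NPclass, PolyReducible L O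

/-- Encoding a list of oracle answers as a number. -/
def encodeBools (l : List Bool) : ℕ := l.foldl (fun n b => 2 * n + (cond b 1 0)) 1

open Classical in
/-- The list of answers of oracle `O` to the first `i` adaptively generated
queries, where the next query is computed by `q` from the input and the
previous answers. -/
noncomputable def answers (O : Set ℕ) (q : ℕ → ℕ) (x : ℕ) : ℕ → List Bool
  | 0 => []
  | i + 1 =>
      answers O q x i ++
        [if q (Nat.pair x (encodeBools (answers O q x i))) ∈ O then true else false]

/-- `P^{O[ℓ]}`: languages decided in deterministic polynomial time with at most
`ℓ(n)` adaptive queries to the oracle `O` (queries generated by the polynomial-time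
function `q`, final decision by the polynomial-time function `d`). -/
def PNPQ (O : Set ℕ) (ℓ : ℕ → ℕ) : Set (Set ℕ) :=
  {L | ∃ q d, PTF q ∧ PTF d ∧
    ∀ x, x ∈ L ↔ d (Nat.pair x (encodeBools (answers O q x (ℓ (len x))))) = 1}

/-- `P^NP`: polynomial time with polynomially many adaptive queries to an
`NP`-complete oracle. -/
def PNPclass : Set (Set ℕ) :=
  {L | ∃ O, NPComplete O ∧ ∃ c, L ∈ PNPQ O (fun n => n ^ c + c)}

/-- `P^{NP[n]}`: at most `n` adaptive queries to an `NP`-complete oracle. -/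
def PNPnClass : Set (Set ℕ) := {L | ∃ O, NPComplete O ∧ L ∈ PNPQ O (fun n => n)}

/-- `P^{NP[c·log n]}`: at most `c·(log n + 1)` adaptive queries to an `NP`-complete oracle. -/
def PNPlogClass (c : ℕ) : Set (Set ℕ) :=
  {L | ∃ O, NPComplete O ∧ L ∈ PNPQ O (fun n => c * (Nat.log 2 n + 1))}

/-- The levels `Σ^p_k` of the polynomial hierarchy. -/
def SigmaP : ℕ → Set (Set ℕ)
  | 0 => Pclass
  | k + 1 =>
      {L | ∃ (c : ℕ) (L' : Set ℕ), L' ∈ SigmaP k ∧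
        ∀ x, x ∈ L ↔ ∃ y, len y ≤ len x ^ c + c ∧ Nat.pair x y ∉ L'}

/-- The polynomial hierarchy `PH`. -/
def PHclass : Set (Set ℕ) := {L | ∃ k, L ∈ SigmaP k}

/-- Output of a randomized oracle machine: decision function `d` applied to input `x`,
random string `r` and the answers to `m` adaptive oracle queries. -/
noncomputable def zppOut (O : Set ℕ) (q d : ℕ → ℕ) (m : ℕ) (x r : ℕ) : ℕ :=
  d (Nat.pair (Nat.pair x r) (encodeBools (answers O q (Nat.pair x r) m)))

/-- `ZPP^{NP[O(log n)]}`: zero-error probabilistic polynomial time with `O(log n)`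
adaptive queries to an `NP`-complete oracle.  The machine outputs `1` (accept),
`0` (reject) or anything else (abort `?`); it is never wrong and aborts with
probability at most `1/2` over the uniformly random string `r`. -/
noncomputable def ZPPNPlogClass : Set (Set ℕ) :=
  {L | ∃ O, NPComplete O ∧ ∃ (c : ℕ) (q d : ℕ → ℕ), PTF q ∧ PTF d ∧
    ∀ x : ℕ,
      (∀ r < 2 ^ (len x ^ c + c),
        (zppOut O q d (c * (Nat.log 2 (len x) + 1)) x r = 1 → x ∈ L) ∧
        (zppOut O q d (c * (Nat.log 2 (len x) + 1)) x r = 0 → x ∉ L)) ∧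
      2 * {r | r < 2 ^ (len x ^ c + c) ∧
            zppOut O q d (c * (Nat.log 2 (len x) + 1)) x r ≠ 1 ∧
            zppOut O q d (c * (Nat.log 2 (len x) + 1)) x r ≠ 0}.ncard
        ≤ 2 ^ (len x ^ c + c)}

/-! ### Kannan's hard language. -/

/-- `T` (a truth table for input length `n`) is hard for circuits of size `n^k`. -/
def TTHard (n k : ℕ) (T : ℕ) : Prop :=
  T < 2 ^ 2 ^ n ∧
    ¬ ∃ C : List ℕ, C.length ≤ n ^ k ∧ ∀ x : ℕ, len x = n → circEval C x.testBit = T.testBit x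

/-- The lexicographically first truth table on length-`n` inputs that is hard for
circuits of size `n^k` (or `0` if none exists). -/
noncomputable def leastHardTT (n k : ℕ) : ℕ := sInf {T | TTHard n k T}

/-- The language whose length-`n` slice is the lexicographically first truth table
of a function on length-`n` inputs not computable by circuits of size `n^k`. -/
noncomputable def kannanLang (k : ℕ) : Set ℕ :=
  {x | (leastHardTT (len x) k).testBit x = true}

end CLB

namespace CLB

/-! ### The language `L(PV)`.
`L(PV)` has a function symbol for each polynomial-time algorithm (of each arity,
multi-ary functions being handled via the pairing function), together with the
order relation `≤`.  Equality is built into first-order logic. -/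

/-- Decoding a number as a tuple of arguments. -/
def argAt : ℕ → ℕ → ℕ
  | z, 0 => z.unpair.1
  | z, i + 1 => argAt z.unpair.2 i

def decodeVec (n : ℕ) (z : ℕ) : Fin n → ℕ := fun i => argAt z i.val

/-- `f : (Fin n → ℕ) → ℕ` is a polynomial-time `n`-ary function. -/
def PolyVec (n : ℕ) (f : (Fin n → ℕ) → ℕ) : Prop := PTF (fun z => f (decodeVec n z))

inductive LPVRel : ℕ → Type | le : LPVRel 2

/-- The first-order language of `PV`: a function symbol for every polynomial-time
algorithm, and the relation symbol `≤`. -/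
def LPV : FirstOrder.Language :=
  ⟨fun n => {f : (Fin n → ℕ) → ℕ // PolyVec n f}, LPVRel⟩

/-- The standard model `ℕ`: every function symbol is interpreted by the
polynomial-time function it names. -/
instance : LPV.Structure ℕ where
  funMap f v := f.1 v
  RelMap r v := match r with | LPVRel.le => v 0 ≤ v 1

abbrev BF (n : ℕ) := LPV.BoundedFormula Empty n
abbrev Tm (n : ℕ) := LPV.Term (Empty ⊕ Fin n)

/-! ### Construction of some particular `PV` function symbols. -/

def mkF0 (c : ℕ) : LPV.Functions 0 := ⟨fun _ => c, PTF.const c⟩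

def mkF1 (f : ℕ → ℕ) (h : PTF (fun z => f z.unpair.1)) : LPV.Functions 1 :=
  ⟨fun v => f (v 0), h⟩

def mkF2 (f : ℕ → ℕ → ℕ) (h : PTF (fun z => f z.unpair.1 z.unpair.2.unpair.1)) :
    LPV.Functions 2 :=
  ⟨fun v => f (v 0) (v 1), h⟩

def mkF3 (f : ℕ → ℕ → ℕ → ℕ)
    (h : PTF (fun z => f z.unpair.1 z.unpair.2.unpair.1 z.unpair.2.unpair.2.unpair.1)) :
    LPV.Functions 3 :=
  ⟨fun v => f (v 0) (v 1) (v 2), h⟩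

/-- The constant `0`. -/
def zeroF : LPV.Functions 0 := mkF0 0
/-- The constant `1`. -/
def oneF : LPV.Functions 0 := mkF0 1
/-- The length function `x ↦ |x|`. -/
def lenSym : LPV.Functions 1 := mkF1 len (PTF.lenB.comp PTF.up1)
/-- Circuit size `C ↦ |C|` (number of gates). -/
def csizeSym : LPV.Functions 1 := mkF1 csize (PTF.csizeB.comp PTF.up1)
/-- Circuit evaluation `(C, x) ↦ C(x)`. -/
def cEvalSym : LPV.Functions 2 :=
  mkF2 cEval (PTF.comp2 PTF.cEvalB PTF.up1 (PTF.up1.comp PTF.up2))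
/-- Successor `x ↦ x + 1`. -/
def succSym : LPV.Functions 1 :=
  mkF1 (fun x => x + 1) (PTF.comp2 PTF.add PTF.up1 (PTF.const 1))
/-- `x ↦ x + c`. -/
def addConstSym (c : ℕ) : LPV.Functions 1 :=
  mkF1 (fun x => x + c) (PTF.comp2 PTF.add PTF.up1 (PTF.const c))
/-- `x ↦ 2x + 1`. -/
def dblS1Sym : LPV.Functions 1 :=
  mkF1 (fun x => 2 * x + 1)
    (PTF.comp2 PTF.add (PTF.comp2 PTF.mul (PTF.const 2) PTF.up1) (PTF.const 1))
/-- `x ↦ |x|^k`. -/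
def powLenSym (k : ℕ) : LPV.Functions 1 :=
  mkF1 (fun x => len x ^ k) ((PTF.powc k).comp (PTF.lenB.comp PTF.up1))
/-- The all-ones string of the length of `x`:  `x ↦ 2^{|x|} - 1` (i.e. `1^{(|x|)}`). -/
def onesSym : LPV.Functions 1 :=
  mkF1 (fun x => 2 ^ len x - 1)
    (by
      have h1 : PTF (fun z => 2 ^ (len z.unpair.1 ^ 1)) := (PTF.unaryPow 1).comp PTF.up1
      have h : PTF (fun z => 2 ^ len z.unpair.1) := by simpa using h1
      exact PTF.comp2 PTF.sub h (PTF.const 1))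
/-- The unary clock `x ↦ 1^{(|x|^c)} = 2^{|x|^c} - 1`. -/
def clockSym (c : ℕ) : LPV.Functions 1 :=
  mkF1 (fun x => 2 ^ (len x ^ c) - 1)
    (PTF.comp2 PTF.sub ((PTF.unaryPow c).comp PTF.up1) (PTF.const 1))
/-- Pairing. -/
def pairSym : LPV.Functions 2 := mkF2 Nat.pair (PTF.up1.pairF (PTF.up1.comp PTF.up2))
/-- First projection. -/
def fstSym : LPV.Functions 1 := mkF1 (fun x => x.unpair.1) (PTF.up1.comp PTF.up1)
/-- Second projection. -/
def sndSym : LPV.Functions 1 := mkF1 (fun x => x.unpair.2) (PTF.up2.comp PTF.up1)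
/-- The clocked universal machine: `(s, e, x) ↦` the output of the algorithm with
code `e` on input `x` run for `|s|` steps (and `0` if it has not halted). -/
def timedSym : LPV.Functions 3 :=
  mkF3 (fun s e x =>
      (Nat.Partrec.Code.evaln (len s) (Denumerable.ofNat Nat.Partrec.Code e) x).getD 0)
    (by
      have := PTF.evalnB.comp
        (PTF.up1.pairF ((PTF.up1.comp PTF.up2).pairF
          (PTF.up1.comp (PTF.up2.comp PTF.up2))))
      simpa using this)

/-! ### Formula-building helpers. -/

def xv {n : ℕ} (i : Fin n) : Tm n := Term.var (Sum.inr i)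
def ap1 {n : ℕ} (f : LPV.Functions 1) (t : Tm n) : Tm n := Term.func f ![t]
def ap2 {n : ℕ} (f : LPV.Functions 2) (t s : Tm n) : Tm n := Term.func f ![t, s]
def ap3 {n : ℕ} (f : LPV.Functions 3) (t s u : Tm n) : Tm n := Term.func f ![t, s, u]
def cst {n : ℕ} (f : LPV.Functions 0) : Tm n := Term.func f ![]
def oneT {n : ℕ} : Tm n := cst oneF
def zeroT {n : ℕ} : Tm n := cst zeroF
def leF {n : ℕ} (t s : Tm n) : BF n := BoundedFormula.rel LPVRel.le ![t, s]
def andF {n : ℕ} (φ ψ : BF n) : BF n := (φ.imp ψ.not).not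
def orF {n : ℕ} (φ ψ : BF n) : BF n := φ.not.imp ψ

/-- `θ(t)`: substitution of a term for the topmost (de Bruijn) variable, expressed
via a quantifier: `∀ y (y = t → θ(y))`. -/
def substTop {n : ℕ} (t : Tm n) (θ : BF (n + 1)) : BF n :=
  ((Term.bdEqual (xv (Fin.last n)) (t.liftAt 1 n)).imp θ).all

/-- The bounded existential quantifier `∃ y ≤ t, θ`. -/
def bdEx {n : ℕ} (t : Tm n) (θ : BF (n + 1)) : BF n :=
  (andF (leF (xv (Fin.last n)) (t.liftAt 1 n)) θ).ex

/-- The bounded universal quantifier `∀ y ≤ t, θ`. -/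
def bdAll {n : ℕ} (t : Tm n) (θ : BF (n + 1)) : BF n :=
  ((leF (xv (Fin.last n)) (t.liftAt 1 n)).imp θ).all

/-- `Σ^b_1(PV)`-formulas: a block of bounded existential quantifiers in front of a
quantifier-free formula. -/
inductive IsSigmaB1 : ∀ {n : ℕ}, BF n → Prop
  | of_qf {n : ℕ} {φ : BF n} : φ.IsQF → IsSigmaB1 φ
  | bdex {n : ℕ} (t : Tm n) {φ : BF (n + 1)} : IsSigmaB1 φ → IsSigmaB1 (bdEx t φ)

/-- `Π^b_1(PV)`-formulas. -/
inductive IsPiB1 : ∀ {n : ℕ}, BF n → Prop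
  | of_qf {n : ℕ} {φ : BF n} : φ.IsQF → IsPiB1 φ
  | bdall {n : ℕ} (t : Tm n) {φ : BF (n + 1)} : IsPiB1 φ → IsPiB1 (bdAll t φ)

/-- `Σ^b_2(PV)`-formulas: bounded existential quantifiers in front of a
quantifier-free formula or the negation of a `Σ^b_1`-formula (i.e. a `Π^b_1`-formula). -/
inductive IsSigmaB2 : ∀ {n : ℕ}, BF n → Prop
  | of_pi {n : ℕ} {φ : BF n} : IsPiB1 φ → IsSigmaB2 φ
  | bdex {n : ℕ} (t : Tm n) {φ : BF (n + 1)} : IsSigmaB2 φ → IsSigmaB2 (bdEx t φ)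

/-- Bounded formulas (all quantifiers bounded). -/
inductive IsBdd : ∀ {n : ℕ}, BF n → Prop
  | of_qf {n : ℕ} {φ : BF n} : φ.IsQF → IsBdd φ
  | imp {n : ℕ} {φ ψ : BF n} : IsBdd φ → IsBdd ψ → IsBdd (φ.imp ψ)
  | bdex {n : ℕ} (t : Tm n) {φ : BF (n + 1)} : IsBdd φ → IsBdd (bdEx t φ)
  | bdall {n : ℕ} (t : Tm n) {φ : BF (n + 1)} : IsBdd φ → IsBdd (bdAll t φ)

/-! ### Theories and provability. -/

/-- Provability: by Gödel's completeness theorem we identify provability from a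
first-order theory with semantic consequence. -/
def Proves (T : LPV.Theory) (S : LPV.Sentence) : Prop := T ⊨ᵇ S

/-- `True₀`: the theory of all true universal `L(PV)`-sentences.  (Cook's theory
`PV` is a universal theory sound for the standard model, so `PV ⊆ True₀`; following
the paper, all results are stated for theories containing the corresponding
true sentences, which only strengthens unprovability results.) -/
def True0 : LPV.Theory :=
  {S | (∃ (n : ℕ) (θ : BF n), θ.IsQF ∧ S = θ.alls) ∧ ℕ ⊨ S}

/-- The theory `PV`, taken extensionally (as in the paper, everything works for the
theory of all true universal `L(PV)`-sentences, which contains `PV`). -/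
def PVT : LPV.Theory := True0

/-- `True₁`: the theory of all true `∀Σ^b_1(PV)`-sentences. -/
def True1 : LPV.Theory :=
  {S | (∃ (n : ℕ) (θ : BF n), IsSigmaB1 θ ∧ S = θ.alls) ∧ ℕ ⊨ S}

/-- The length-induction axiom `LIND` for `θ` (with the induction variable the
topmost variable, all other variables universally quantified parameters):
`θ(0) ∧ ∀ x (θ(x) → θ(x+1)) → ∀ x θ(|x|)`. -/
def LINDax {n : ℕ} (θ : BF (n + 1)) : LPV.Sentence :=
  ((andF (substTop zeroT θ)
      ((θ.imp (((Term.bdEqual (xv (⟨n + 1, by omega⟩ : Fin (n + 2)))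
          (ap1 succSym (xv (⟨n, by omega⟩ : Fin (n + 2))))).imp (θ.liftAt 1 n)).all)).all)).imp
    ((((Term.bdEqual (xv (⟨n + 1, by omega⟩ : Fin (n + 2)))
        (ap1 lenSym (xv (⟨n, by omega⟩ : Fin (n + 2))))).imp (θ.liftAt 1 n)).all).all)).alls

/-- The induction axiom `IND` for `θ`:  `θ(0) ∧ ∀ x (θ(x) → θ(x+1)) → ∀ x θ(x)`. -/
def INDax {n : ℕ} (θ : BF (n + 1)) : LPV.Sentence :=
  ((andF (substTop zeroT θ)
      ((θ.imp (((Term.bdEqual (xv (⟨n + 1, by omega⟩ : Fin (n + 2)))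
          (ap1 succSym (xv (⟨n, by omega⟩ : Fin (n + 2))))).imp (θ.liftAt 1 n)).all)).all)).imp
    θ.all).alls

/-- The `Σ^b_1(PV)`-LIND scheme. -/
def LIND1 : LPV.Theory := {S | ∃ (n : ℕ) (θ : BF (n + 1)), IsSigmaB1 θ ∧ S = LINDax θ}

/-- The `Σ^b_1(PV)`-IND scheme. -/
def IND1 : LPV.Theory := {S | ∃ (n : ℕ) (θ : BF (n + 1)), IsSigmaB1 θ ∧ S = INDax θ}

/-- The `Σ^b_2(PV)`-LIND scheme. -/
def LIND2 : LPV.Theory := {S | ∃ (n : ℕ) (θ : BF (n + 1)), IsSigmaB2 θ ∧ S = LINDax θ}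

/-- The surjective weak pigeonhole principle for the function symbol `f` (with a
parameter): `∀ p ∀ a ∃ v ≤ 2a+1 ∀ u ≤ a, f(p,u) ≠ v`. -/
def sWPHPax (f : LPV.Functions 2) : LPV.Sentence :=
  let inner : BF 4 :=
    (leF (xv (3 : Fin 4)) (xv (1 : Fin 4))).imp
      ((Term.bdEqual (ap2 f (xv (0 : Fin 4)) (xv (3 : Fin 4))) (xv (2 : Fin 4))).not)
  let block : BF 3 :=
    andF (leF (xv (2 : Fin 3)) (ap1 dblS1Sym (xv (1 : Fin 3)))) inner.all
  block.ex.all.all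

/-- `sWPHP(PV)`: the surjective weak pigeonhole principle for all `PV` function symbols. -/
def sWPHPthy : LPV.Theory := {S | ∃ f : LPV.Functions 2, S = sWPHPax f}

/-! ### The sentences `UB^k_io(φ)` and friends. -/

/-- The language defined by the `L(PV)`-formula `φ(x)` in the standard model. -/
def LangOf (φ : BF 1) : Set ℕ := {x | φ.Realize (fun e => e.elim) ![x]}

/-- The atomic formula `f(x) = 1` defining the language of the `PV` function symbol `f`. -/
def atomicF (f : LPV.Functions 1) : BF 1 :=
  Term.bdEqual (ap1 f (xv (0 : Fin 1))) oneT

/-- The sentence `UB^k_io(φ)`: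
`∀ 1^{(n)} ∃ 1^{(m)} (m ≥ n) ∃ C_m (|C_m| ≤ m^k) ∀ x (|x| = m), φ(x) ≡ (C_m(x) = 1)`,
formalizing that the boolean functions defined by `φ` are computed on infinitely many
input lengths `m` by circuits with at most `m^k` gates.  (Variables: `y` with `n = |y|`,
`z` with `m = |z|`, the circuit `C`, and the input `x`.) -/
def UBio (k : ℕ) (φ : BF 1) : LPV.Sentence :=
  let inner : BF 4 :=
    (Term.bdEqual (ap1 lenSym (xv (3 : Fin 4))) (ap1 lenSym (xv (1 : Fin 4)))).imp
      ((φ.liftAt 3 0).iff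
        (Term.bdEqual (ap2 cEvalSym (xv (2 : Fin 4)) (xv (3 : Fin 4))) oneT))
  let block : BF 3 :=
    andF (leF (ap1 lenSym (xv (0 : Fin 3))) (ap1 lenSym (xv (1 : Fin 3))))
      (andF (leF (ap1 csizeSym (xv (2 : Fin 3))) (ap1 (powLenSym k) (xv (1 : Fin 3))))
        inner.all)
  block.ex.ex.all

/-- The sentence expressing that the language of `φ` has circuits of size `m^c + c`
on every sufficiently large input length `m` (`φ ∈ SIZE[poly]`, witnessed by the
exponent `c`). -/
def UBae (c : ℕ) (φ : BF 1) : LPV.Sentence :=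
  let inner : BF 4 :=
    (Term.bdEqual (ap1 lenSym (xv (3 : Fin 4))) (ap1 lenSym (xv (1 : Fin 4)))).imp
      ((φ.liftAt 3 0).iff
        (Term.bdEqual (ap2 cEvalSym (xv (2 : Fin 4)) (xv (3 : Fin 4))) oneT))
  let block : BF 3 :=
    andF
      (leF (ap1 csizeSym (xv (2 : Fin 3)))
        (ap1 (addConstSym c) (ap1 (powLenSym c) (xv (1 : Fin 3)))))
      inner.all
  let quant : BF 2 :=
    (leF (ap1 lenSym (xv (0 : Fin 2))) (ap1 lenSym (xv (1 : Fin 2)))).imp block.ex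
  quant.all.ex

/-- The sentence expressing that the language of `φ` has circuits of size `m^c + c`
on every input length `m`. -/
def UBevery (c : ℕ) (φ : BF 1) : LPV.Sentence :=
  let inner : BF 3 :=
    (Term.bdEqual (ap1 lenSym (xv (2 : Fin 3))) (ap1 lenSym (xv (0 : Fin 3)))).imp
      ((φ.liftAt 2 0).iff
        (Term.bdEqual (ap2 cEvalSym (xv (1 : Fin 3)) (xv (2 : Fin 3))) oneT))
  let block : BF 2 :=
    andF
      (leF (ap1 csizeSym (xv (1 : Fin 2)))
        (ap1 (addConstSym c) (ap1 (powLenSym c) (xv (0 : Fin 2)))))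
      inner.all
  block.ex.all

/-- `LB^k_tt(h) = ¬ UB^k_io(h)`: the language of `h` is hard for circuits of size
`m^k` on every input length `m ≥ n`, for some fixed `n`. -/
def LBtt (k : ℕ) (h : LPV.Functions 1) : LPV.Sentence := (UBio k (atomicF h)).not

end CLB

namespace CLB

/-! ### Further sentences used in the statements. -/

/-- The sentence expressing (provable) paddability of the encoding of the language
defined by `φ`, via the padding function symbol `pd`:
`∀ x ∀ z (|x| ≤ |z| → |pd(x,z)| = |z| ∧ (φ(pd(x,z)) ↔ φ(x)))`. -/
def padSent (φ : BF 1) (pd : LPV.Functions 2) : LPV.Sentence :=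
  let t : Tm 2 := ap2 pd (xv (0 : Fin 2)) (xv (1 : Fin 2))
  let phiAt : Tm 2 → BF 2 := fun s =>
    ((Term.bdEqual (xv (2 : Fin 3)) (s.liftAt 1 2)).imp (φ.liftAt 2 0)).all
  let inner : BF 2 :=
    (leF (ap1 lenSym (xv (0 : Fin 2))) (ap1 lenSym (xv (1 : Fin 2)))).imp
      (andF (Term.bdEqual (ap1 lenSym t) (ap1 lenSym (xv (1 : Fin 2))))
        ((phiAt t).iff (phiAt (xv (0 : Fin 2)))))
  inner.alls

/-- The sentence `PNP(ψ) = ∀ x ∀ y (ψ(x,y) → ψ(x, f(x)))`: the polynomial-time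
algorithm `f` finds satisfying assignments for all satisfiable formulas (where
`ψ(x,y)` expresses that `y` satisfies the formula encoded by `x`). -/
def PNPsent (ψ : BF 2) (f : LPV.Functions 1) : LPV.Sentence :=
  (ψ.imp ((substTop (ap1 f (xv (0 : Fin 1))) ψ).liftAt 1 1)).all.all

/-- The satisfaction relation of the `NP`-complete satisfiability problem:
`y` encodes a satisfying assignment of the (circuit form of the) propositional
formula encoded by `x`. -/
def SatRel (x y : ℕ) : Prop := circEval (cDecode x) y.testBit = true

/-- The sentence expressing that `g` is hard on all input lengths against every
algorithm (code `e`) running in time `|x|^{k'-1}` that uses an advice string `w`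
with `|w| ≤ n^{k'}`:
`∀ e ∀ w ∀ 1^{(n)} (|w| ≤ n^{k'} → ∃ x (|x| = n ∧ e(w,x) ≠ g(x)))`. -/
def hardSent (g : LPV.Functions 1) (k' : ℕ) : LPV.Sentence :=
  let run : Tm 4 :=
    ap3 timedSym (ap1 (clockSym (k' - 1)) (xv (3 : Fin 4))) (xv (0 : Fin 4))
      (ap2 pairSym (xv (1 : Fin 4)) (xv (3 : Fin 4)))
  let inner : BF 4 :=
    andF (Term.bdEqual (ap1 lenSym (xv (3 : Fin 4))) (ap1 lenSym (xv (2 : Fin 4))))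
      ((Term.bdEqual run (ap1 g (xv (3 : Fin 4)))).not)
  let body : BF 3 :=
    (leF (ap1 lenSym (xv (1 : Fin 3))) (ap1 (powLenSym k') (xv (2 : Fin 3)))).imp inner.ex
  body.all.all.all

/-- The term `f_i(1^{(n)}, x_1, …, x_{i-1})` in the context with variables
`y = x₀` (the string `1^{(n)}`) and `x_1, …, x_r`. -/
def kptTerm (r : ℕ) (f : (i : Fin r) → LPV.Functions (i + 1)) (i : Fin r) : Tm (r + 1) :=
  Term.func (f i) (fun j => xv ⟨j.val, by have := j.isLt; have := i.isLt; omega⟩)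

/-- The `i`-th disjunct of the KPT disjunction: writing
`(1^{(n_i)}, C^i) := f_i(1^{(n)}, x_1, …, x_{i-1})`, it says
`n_i ≥ n ∧ |C^i| ≤ n_i^k ∧ (|x_i| = n_i → C^i(x_i) = g(x_i))`. -/
def kptDisjunct (k : ℕ) (g : LPV.Functions 1) (r : ℕ)
    (f : (i : Fin r) → LPV.Functions (i + 1)) (i : Fin r) : BF (r + 1) :=
  let t := kptTerm r f i
  let ni : Tm (r + 1) := ap1 lenSym (ap1 fstSym t)
  let Ci : Tm (r + 1) := ap1 sndSym t
  let xi : Tm (r + 1) := xv ⟨i.val + 1, by have := i.isLt; omega⟩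
  andF (leF (ap1 lenSym (xv (⟨0, by omega⟩ : Fin (r + 1)))) ni)
    (andF (leF (ap1 csizeSym Ci) (ap1 (powLenSym k) (ap1 fstSym t)))
      ((Term.bdEqual (ap1 lenSym xi) ni).imp
        (Term.bdEqual (ap2 cEvalSym Ci xi) (ap1 g xi))))

/-- The universal closure of the KPT disjunction obtained by applying the KPT
witnessing theorem to `UB^k_io(g)`. -/
def kptSent (k : ℕ) (g : LPV.Functions 1) (r : ℕ)
    (f : (i : Fin r) → LPV.Functions (i + 1)) : LPV.Sentence :=
  ((List.finRange r).foldr (fun i acc => orF (kptDisjunct k g r f i) acc)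
    BoundedFormula.falsum).alls

/-- The universal closure of `n_i ≤ n^{a_i}`, i.e.
`|fst (f_i(1^{(n)}, x_1, …, x_{i-1}))| ≤ |1^{(n)}|^{a_i} + a_i` (provable polynomial
bound on the output length parameter of the KPT function `f_i`). -/
def lenBoundSent (r : ℕ) (f : (i : Fin r) → LPV.Functions (i + 1)) (i : Fin r)
    (a : ℕ) : LPV.Sentence :=
  (leF (ap1 lenSym (ap1 fstSym (kptTerm r f i)))
    (ap1 (addConstSym a) (ap1 (powLenSym a) (xv (⟨0, by omega⟩ : Fin (r + 1)))))).alls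

/-- `⌊n^{1/c}⌋`. -/
def nthRoot (c n : ℕ) : ℕ := Nat.findGreatest (fun m => m ^ c ≤ n) n

/-- The padded succinct direct-connection language `L¹_succ` of the circuits
produced by the first KPT function `f₁`: its members are tuples
`⟨Bin(n), 1^{(n^{1/10k})}, u, v, w, 1^t⟩` (encoded by iterated pairing, with the
padding parameter `t` arbitrary and ignored) such that gate `u` of the circuit
`C¹ := snd (f₁(1^{(n)}))` is described by the pair `(v, w)`. -/
def LtildeFun (k : ℕ) (f1 : LPV.Functions 1) (z : ℕ) : ℕ :=
  let n := z.unpair.1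
  let pad := z.unpair.2.unpair.1
  let u := z.unpair.2.unpair.2.unpair.1
  let v := z.unpair.2.unpair.2.unpair.2.unpair.1
  let w := z.unpair.2.unpair.2.unpair.2.unpair.2.unpair.1
  let C := cDecode (f1.1 ![2 ^ n - 1]).unpair.2
  if pad = 2 ^ nthRoot (10 * k) n - 1 ∧ C.getD u 0 = Nat.pair v w then 1 else 0

/-- The sentence stating that `u₁` enumerates (all-ones) input parameters
`1^{(n)} = u₁(1^{(ℓ)})` with `n ≥ ℓ` and `|u₁(1^{(ℓ)})| ≤ ℓ^{c₁} + c₁`, and that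
`e₁(1^{(ℓ)})` is a counter-example of length `n₁ = |fst(f₁(u₁(1^{(ℓ)})))|` on which the
circuit `snd(f₁(u₁(1^{(ℓ)})))` produced by `f₁` fails to compute `g`. -/
def ceSent (g f1 u1 e1 : LPV.Functions 1) (c1 : ℕ) : LPV.Sentence :=
  let y : Tm 1 := xv (0 : Fin 1)
  let uy : Tm 1 := ap1 u1 y
  let ey : Tm 1 := ap1 e1 y
  let n1 : Tm 1 := ap1 lenSym (ap1 fstSym (ap1 f1 uy))
  let C1 : Tm 1 := ap1 sndSym (ap1 f1 uy)
  (andF (Term.bdEqual uy (ap1 onesSym uy))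
    (andF (leF (ap1 lenSym y) (ap1 lenSym uy))
      (andF (leF (ap1 lenSym uy) (ap1 (addConstSym c1) (ap1 (powLenSym c1) y)))
        (andF (Term.bdEqual (ap1 lenSym ey) n1)
          ((Term.bdEqual (ap1 g ey) (ap2 cEvalSym C1 ey)).not))))).alls

end CLB



namespace CLB

/-! ### Binary lengths. -/

theorem len_le_iff {x n : ℕ} : len x ≤ n ↔ x < 2 ^ n := Nat.size_le
theorem lt_pow_len (x : ℕ) : x < 2 ^ len x := Nat.lt_size_self x
theorem len_mono {x y : ℕ} (h : x ≤ y) : len x ≤ len y := Nat.size_le_size h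
theorem len_pow (n : ℕ) : len (2 ^ n) = n + 1 := Nat.size_pow
theorem len_le_self (x : ℕ) : len x ≤ x := len_le_iff.2 Nat.lt_two_pow_self
theorem len_eq_bits (x : ℕ) : x.bits.length = len x := Nat.size_eq_bits_len x
theorem lt_len_iff {m n : ℕ} : m < len n ↔ 2 ^ m ≤ n := Nat.lt_size
theorem len_zero : len 0 = 0 := Nat.size_zero
theorem len_pos {n : ℕ} (h : 0 < n) : 0 < len n := Nat.size_pos.2 h

theorem len_eq_of {x m : ℕ} (h1 : 2 ^ m ≤ x) (h2 : x < 2 ^ (m + 1)) : len x = m + 1 := by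
  have a := len_le_iff.2 h2
  have b := lt_len_iff.2 h1
  omega

theorem len_add (a b : ℕ) : len (a + b) ≤ max (len a) (len b) + 1 := by
  rw [len_le_iff, pow_succ]
  have h1 := (lt_pow_len a).trans_le (Nat.pow_le_pow_right (by norm_num) (le_max_left (len a) (len b)))
  have h2 := (lt_pow_len b).trans_le (Nat.pow_le_pow_right (by norm_num) (le_max_right (len a) (len b)))
  omega

theorem len_mul (a b : ℕ) : len (a * b) ≤ len a + len b := by
  rw [len_le_iff, pow_add]
  exact Nat.mul_lt_mul'' (lt_pow_len a) (lt_pow_len b)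

theorem len_pair (a b : ℕ) : len (Nat.pair a b) ≤ 2 * max (len a) (len b) := by
  rw [len_le_iff, mul_comm, pow_mul]
  have h1 := (lt_pow_len a).trans_le (Nat.pow_le_pow_right (by norm_num) (le_max_left (len a) (len b)))
  have h2 := (lt_pow_len b).trans_le (Nat.pow_le_pow_right (by norm_num) (le_max_right (len a) (len b)))
  refine (Nat.pair_lt_max_add_one_sq a b).trans_le ?_
  exact Nat.pow_le_pow_left (by omega) 2

theorem len_up1 (z : ℕ) : len z.unpair.1 ≤ len z := len_mono (Nat.unpair_left_le z)
theorem len_up2 (z : ℕ) : len z.unpair.2 ≤ len z := len_mono (Nat.unpair_right_le z)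
theorem len_pair_left (a b : ℕ) : len a ≤ len (Nat.pair a b) := len_mono (Nat.left_le_pair a b)
theorem len_pair_right (a b : ℕ) : len b ≤ len (Nat.pair a b) := len_mono (Nat.right_le_pair a b)

theorem len_div2 (y : ℕ) : len ((y + 1) / 2) + 1 = len (y + 1) := by
  have h : Nat.bit ((y + 1).bodd) ((y + 1) / 2) = y + 1 := by
    have := Nat.bit_bodd_div2 (y + 1)
    rwa [Nat.div2_val] at this
  have h2 := @Nat.size_bit ((y + 1).bodd) ((y + 1) / 2) (by omega)
  rw [h] at h2
  exact h2.symm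

theorem pow_len_pred (y : ℕ) : 2 ^ len (y + 1) / 2 = 2 ^ len ((y + 1) / 2) := by
  rw [← len_div2, pow_succ]; simp

/-! ### Closure properties of `PTF`. -/

theorem PTF.congr {f g : ℕ → ℕ} (h : PTF f) (e : ∀ z, f z = g z) : PTF g := (funext e) ▸ h
theorem PTF.fst {f : ℕ → ℕ} (h : PTF f) : PTF (fun z => (f z).unpair.1) := PTF.up1.comp h
theorem PTF.snd {f : ℕ → ℕ} (h : PTF f) : PTF (fun z => (f z).unpair.2) := PTF.up2.comp h
theorem PTF.len' {f : ℕ → ℕ} (h : PTF f) : PTF (fun z => len (f z)) := PTF.lenB.comp h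
theorem PTF.add' {f g : ℕ → ℕ} (hf : PTF f) (hg : PTF g) : PTF (fun z => f z + g z) :=
  PTF.comp2 (F := fun a b => a + b) PTF.add hf hg
theorem PTF.sub' {f g : ℕ → ℕ} (hf : PTF f) (hg : PTF g) : PTF (fun z => f z - g z) :=
  PTF.comp2 (F := fun a b => a - b) PTF.sub hf hg
theorem PTF.mul' {f g : ℕ → ℕ} (hf : PTF f) (hg : PTF g) : PTF (fun z => f z * g z) :=
  PTF.comp2 (F := fun a b => a * b) PTF.mul hf hg
theorem PTF.div' {f g : ℕ → ℕ} (hf : PTF f) (hg : PTF g) : PTF (fun z => f z / g z) :=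
  PTF.comp2 (F := fun a b => a / b) PTF.div hf hg
theorem PTF.mod' {f g : ℕ → ℕ} (hf : PTF f) (hg : PTF g) : PTF (fun z => f z % g z) :=
  PTF.comp2 (F := fun a b => a % b) PTF.mod hf hg
theorem PTF.smash' {f g : ℕ → ℕ} (hf : PTF f) (hg : PTF g) :
    PTF (fun z => 2 ^ (len (f z) * len (g z))) :=
  PTF.comp2 (F := fun a b => 2 ^ (len a * len b)) PTF.smash hf hg
theorem PTF.cEval' {f g : ℕ → ℕ} (hf : PTF f) (hg : PTF g) :
    PTF (fun z => cEval (f z) (g z)) :=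
  PTF.comp2 (F := cEval) PTF.cEvalB hf hg
theorem PTF.powLen {f : ℕ → ℕ} (hf : PTF f) (c : ℕ) : PTF (fun z => 2 ^ (len (f z) ^ c)) :=
  (PTF.unaryPow c).comp hf
theorem PTF.powLen1 {f : ℕ → ℕ} (hf : PTF f) : PTF (fun z => 2 ^ len (f z)) :=
  (hf.powLen 1).congr (fun z => by simp)

theorem PTF.ite' {f g h : ℕ → ℕ} (hf : PTF f) (hg : PTF g) (hh : PTF h) :
    PTF (fun z => if f z = 0 then g z else h z) :=
  (PTF.ite0.comp (hf.pairF (hg.pairF hh))).congr (fun z => by simp)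

/-- Polynomial-time predicates. -/
def PTP (P : ℕ → Prop) : Prop := ∃ f, PTF f ∧ ∀ z, P z ↔ f z = 0

open Classical in
theorem PTP.ite {P : ℕ → Prop} {f g : ℕ → ℕ} (hP : PTP P) (hf : PTF f) (hg : PTF g) :
    PTF (fun z => if P z then f z else g z) := by
  obtain ⟨p, hp, e⟩ := hP
  exact (hp.ite' hf hg).congr (fun z => by simp only [e])

theorem PTP.congr {P Q : ℕ → Prop} (h : PTP P) (e : ∀ z, P z ↔ Q z) : PTP Q := by
  obtain ⟨f, hf, h⟩ := h
  exact ⟨f, hf, fun z => (e z).symm.trans (h z)⟩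

theorem PTP.not {P : ℕ → Prop} (h : PTP P) : PTP (fun z => ¬ P z) := by
  obtain ⟨f, hf, h⟩ := h
  refine ⟨_, (PTF.const 1).sub' hf, fun z => ?_⟩
  simp only [h]; omega

theorem PTP.and {P Q : ℕ → Prop} (h : PTP P) (h' : PTP Q) : PTP (fun z => P z ∧ Q z) := by
  obtain ⟨f, hf, h⟩ := h
  obtain ⟨g, hg, h'⟩ := h'
  refine ⟨_, hf.add' hg, fun z => ?_⟩
  simp only [h, h']; omega

theorem PTP.imp {P Q : ℕ → Prop} (h : PTP P) (h' : PTP Q) : PTP (fun z => P z → Q z) :=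
  (h.and h'.not).not.congr (fun z => by tauto)

theorem PTP.iff {P Q : ℕ → Prop} (h : PTP P) (h' : PTP Q) : PTP (fun z => P z ↔ Q z) :=
  ((h.imp h').and (h'.imp h)).congr (fun z => by tauto)

theorem PTF.leP {f g : ℕ → ℕ} (hf : PTF f) (hg : PTF g) : PTP (fun z => f z ≤ g z) :=
  ⟨_, hf.sub' hg, fun z => by omega⟩

theorem PTF.eqP {f g : ℕ → ℕ} (hf : PTF f) (hg : PTF g) : PTP (fun z => f z = g z) :=
  ((hf.leP hg).and (hg.leP hf)).congr (fun z => by omega)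

/-! ### Polynomial growth. -/

/-- Polynomially bounded output length. -/
def PB (f : ℕ → ℕ) : Prop := ∃ c, ∀ z, len (f z) ≤ (len z + 2) ^ c

theorem pow_base_mono {n c d : ℕ} (h : c ≤ d) : (n + 2) ^ c ≤ (n + 2) ^ d :=
  Nat.pow_le_pow_right (by omega) h

theorem le_pow_base (n c : ℕ) : c ≤ (n + 2) ^ c :=
  (Nat.lt_two_pow_self).le.trans (Nat.pow_le_pow_left (by omega) c)

theorem PB.of_le {f g : ℕ → ℕ} (h : PB g) (e : ∀ z, len (f z) ≤ len (g z)) : PB f := by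
  obtain ⟨c, hc⟩ := h
  exact ⟨c, fun z => (e z).trans (hc z)⟩

theorem csize_le (z : ℕ) : csize z ≤ len z := by
  have : ∀ f l, (decodeLN f l).length ≤ f := by
    intro f
    induction f with
    | zero => intro l; simp [decodeLN]
    | succ f ih =>
      intro l
      cases l with
      | nil => simp [decodeLN]
      | cons a l => simp only [decodeLN, List.length_cons]; have := ih (parseNum (a :: l) 0).2; omega
  unfold csize cDecode
  rw [← len_eq_bits]
  exact this _ _

theorem cEval_le (c x : ℕ) : cEval c x ≤ 1 := by
  unfold cEval; cases circEval (cDecode c) x.testBit <;> simp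

theorem len_sq_aux (a P : ℕ) (hP : a * a ≤ P) : 2 * len (a + 1) ≤ len (4 * P + 5) := by
  have hpos : 0 < len (a + 1) := len_pos (by omega)
  obtain ⟨t, ht⟩ : ∃ t, len (a + 1) = t + 1 := ⟨len (a + 1) - 1, by omega⟩
  have h3 : 2 ^ t ≤ a + 1 := lt_len_iff.1 (by omega)
  have : 2 * t + 1 < len (4 * P + 5) := by
    rw [lt_len_iff]
    have e : 2 ^ (2 * t + 1) = 2 * (2 ^ t * 2 ^ t) := by
      rw [← pow_add, ← pow_succ']; congr 1; omega
    rw [e]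
    have hs : 1 ≤ 2 ^ t := Nat.one_le_two_pow
    generalize 2 ^ t = s at *
    zify at *
    nlinarith [sq_nonneg ((s : ℤ) - 2), mul_nonneg (by linarith : (0 : ℤ) ≤ a + 1 - s)
      (by linarith : (0 : ℤ) ≤ a + s - 1)]
  omega

theorem len_code_left (a b : ℕ) : 2 * len (a + 1) ≤ len (4 * Nat.pair a b + 5) := by
  apply len_sq_aux
  unfold Nat.pair; split_ifs with h
  · nlinarith
  · omega

theorem len_code_right (a b : ℕ) : 2 * len (b + 1) ≤ len (4 * Nat.pair a b + 5) := by
  apply len_sq_aux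
  unfold Nat.pair; split_ifs with h
  · omega
  · nlinarith

open Nat.Partrec Nat.Partrec.Code in
theorem evaln_growth (c : Nat.Partrec.Code) : ∀ k n x, x ∈ evaln k c n →
    len x ≤ len k * len (encodeCode c + 1) := by
  have pos : ∀ c, 1 ≤ len (encodeCode c + 1) := fun c => len_pos (by omega)
  have small : ∀ {k c x}, x ≤ k → len x ≤ len k * len (encodeCode c + 1) := by
    intro k c x h
    exact (len_mono h).trans (Nat.le_mul_of_pos_right _ (pos c))
  induction c with
  | zero | succ | left | right =>
    intro k n x h
    cases k with
    | zero => simp [evaln] at h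
    | succ k =>
      simp [evaln, Option.bind_eq_some_iff] at h
      obtain ⟨h1, h2⟩ := h
      apply small
      have := Nat.unpair_left_le n
      have := Nat.unpair_right_le n
      omega
  | pair cf cg hf hg =>
    intro k n x h
    cases k with
    | zero => simp [evaln] at h
    | succ k =>
      simp [evaln, Option.bind_eq_some_iff, Seq.seq] at h
      obtain ⟨_, a, ha, b, hb, rfl⟩ := h
      have h1 := hf _ _ _ ha
      have h2 := hg _ _ _ hb
      have e1 := len_code_left (encodeCode cf) (encodeCode cg)
      have e2 := len_code_right (encodeCode cf) (encodeCode cg)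
      have e3 : encodeCode (cf.pair cg) + 1 = 4 * Nat.pair (encodeCode cf) (encodeCode cg) + 5 := by
        simp only [encodeCode]; ring
      rw [e3]
      have m1 := Nat.mul_le_mul_left (len (k + 1)) e1
      have m2 := Nat.mul_le_mul_left (len (k + 1)) e2
      have := len_pair a b
      have hm : max (len a) (len b) = len a ∨ max (len a) (len b) = len b := by omega
      rcases hm with h | h <;> rw [h] at this <;> nlinarith
  | comp cf cg hf hg =>
    intro k n x h
    cases k with
    | zero => simp [evaln] at h
    | succ k =>
      simp [evaln, Option.bind_eq_some_iff] at h
      obtain ⟨_, a, ha, hx⟩ := h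
      refine (hf _ _ _ hx).trans (Nat.mul_le_mul_left _ (len_mono ?_))
      simp only [encodeCode]
      have := Nat.left_le_pair (encodeCode cf) (encodeCode cg)
      omega
  | prec cf cg hf hg =>
    intro k n x h
    have hl := Nat.left_le_pair (encodeCode cf) (encodeCode cg)
    have hr := Nat.right_le_pair (encodeCode cf) (encodeCode cg)
    cases k with
    | zero => simp [evaln] at h
    | succ k =>
      simp only [evaln, Option.mem_def, Option.bind_eq_bind, Option.bind_eq_some_iff,
        Nat.unpaired] at h
      obtain ⟨_, _, h⟩ := h
      cases hn : n.unpair.2 with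
      | zero =>
        rw [hn] at h
        refine (hf _ _ _ h).trans (Nat.mul_le_mul_left _ (len_mono ?_))
        simp only [encodeCode]
        omega
      | succ y =>
        rw [hn] at h
        simp only [Option.bind_eq_some_iff] at h
        obtain ⟨i, _, h⟩ := h
        refine (hg _ _ _ h).trans (Nat.mul_le_mul_left _ (len_mono ?_))
        simp only [encodeCode]
        omega
  | rfind' cf hf =>
    intro k
    induction k with
    | zero => intro n x h; simp [evaln] at h
    | succ k ih =>
      intro n x h
      have hb := evaln_bound h
      simp only [evaln, Option.mem_def, Option.bind_eq_bind, Option.bind_eq_some_iff,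
        Nat.unpaired] at h
      obtain ⟨_, _, a, ha, h⟩ := h
      split_ifs at h with h0
      · have := Nat.unpair_right_le n
        apply small
        simp at h
        omega
      · exact (ih _ _ h).trans (Nat.mul_le_mul_right _ (len_mono (by omega)))

theorem PB.comp {f g : ℕ → ℕ} (hf : PB f) (hg : PB g) : PB (fun z => f (g z)) := by
  obtain ⟨c, hc⟩ := hf
  obtain ⟨d, hd⟩ := hg
  refine ⟨(d + 2) * c, fun z => (hc _).trans ?_⟩
  rw [pow_mul]
  apply Nat.pow_le_pow_left
  have := hd z
  have h1 : 1 ≤ (len z + 2) ^ d := Nat.one_le_pow _ _ (by omega)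
  rw [pow_add]
  have h4 : 4 ≤ (len z + 2) ^ 2 := Nat.pow_le_pow_left (by omega : 2 ≤ len z + 2) 2
  have := Nat.mul_le_mul_left ((len z + 2) ^ d) h4
  omega

/-- a polynomial bound of the shape `A * n^B + C` suffices. -/
theorem PB.of_bound {f : ℕ → ℕ} (A B C : ℕ) (h : ∀ z, len (f z) ≤ A * len z ^ B + C) : PB f := by
  refine ⟨A + B + C + 1, fun z => (h z).trans ?_⟩
  have h1 := le_pow_base (len z) A
  have h2 : len z ^ B ≤ (len z + 2) ^ B := Nat.pow_le_pow_left (by omega) B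
  have h3 := le_pow_base (len z) C
  have h4 : A * len z ^ B ≤ (len z + 2) ^ (A + B + C) := by
    refine (Nat.mul_le_mul h1 h2).trans ?_
    rw [← pow_add]; exact pow_base_mono (by omega)
  have h5 := h3.trans (pow_base_mono (n := len z) (by omega : C ≤ A + B + C))
  rw [pow_succ]
  nlinarith

theorem PTF.growth {f : ℕ → ℕ} (h : PTF f) : PB f := by
  induction h with
  | id' => exact PB.of_bound 1 1 0 (by simp)
  | const c => exact PB.of_bound 0 0 (len c) (by simp)
  | up1 => exact PB.of_bound 1 1 0 (by simpa using len_up1)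
  | up2 => exact PB.of_bound 1 1 0 (by simpa using len_up2)
  | lenB => exact PB.of_bound 1 1 0 (by intro z; simpa using len_le_self (len z))
  | add =>
    refine PB.of_bound 1 1 1 fun z => (len_add _ _).trans ?_
    have := len_up1 z
    have := len_up2 z
    simp; omega
  | sub => exact PB.of_bound 1 1 0 (by intro z; simpa using (len_mono (Nat.sub_le _ _)).trans (len_up1 z))
  | mul =>
    refine PB.of_bound 2 1 0 fun z => (len_mul _ _).trans ?_
    have := len_up1 z
    have := len_up2 z
    simp; omega
  | div => exact PB.of_bound 1 1 0 (by intro z; simpa using (len_mono (Nat.div_le_self _ _)).trans (len_up1 z))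
  | mod => exact PB.of_bound 1 1 0 (by intro z; simpa using (len_mono (Nat.mod_le _ _)).trans (len_up1 z))
  | smash =>
    refine PB.of_bound 1 2 1 fun z => ?_
    rw [len_pow]
    have := Nat.mul_le_mul (len_up1 z) (len_up2 z)
    rw [pow_two]; omega
  | unaryPow c => exact PB.of_bound 1 c 1 (by intro z; simp [len_pow])
  | powc c =>
    refine PB.of_bound c 1 1 fun z => ?_
    induction c with
    | zero => simp [len]
    | succ c ih =>
      rw [pow_succ]
      have := len_mul (z ^ c) z
      rw [pow_one] at *
      have e : (c + 1) * len z = c * len z + len z := by ring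
      omega
  | ite0 =>
    refine PB.of_bound 1 1 0 fun z => ?_
    have h1 := (len_up1 z.unpair.2).trans (len_up2 z)
    have h2 := (len_up2 z.unpair.2).trans (len_up2 z)
    split_ifs <;> simpa
  | csizeB =>
    exact PB.of_bound 1 1 0 (by intro z; simpa using (len_le_self (csize z)).trans (csize_le z))
  | cEvalB =>
    exact PB.of_bound 0 0 1 (by intro z; simpa using (len_le_self _).trans (cEval_le _ _))
  | evalnB =>
    refine PB.of_bound 2 2 10 fun z => ?_
    cases h : (Nat.Partrec.Code.evaln (len z.unpair.1)
        (Denumerable.ofNat Nat.Partrec.Code z.unpair.2.unpair.1) z.unpair.2.unpair.2) with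
    | none => simp [len_zero]
    | some x =>
      have := evaln_growth _ _ _ _ h
      rw [← Nat.Partrec.Code.encodeCode_eq, Denumerable.encode_ofNat] at this
      simp only [Option.getD_some]
      refine this.trans ?_
      have h1 := (len_le_self (len z.unpair.1)).trans (len_up1 z)
      have h2 := (len_up1 z.unpair.2).trans (len_up2 z)
      have h3 := len_add z.unpair.2.unpair.1 1
      have h4 : len 1 = 1 := Nat.size_one
      have h5 : len (z.unpair.2.unpair.1 + 1) ≤ len z + 2 := by omega
      have := Nat.mul_le_mul h1 h5
      nlinarith
  | comp _ _ hf hg => exact hf.comp hg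
  | pairF _ _ hf hg =>
    obtain ⟨c, hc⟩ := hf
    obtain ⟨d, hd⟩ := hg
    refine ⟨c + d + 1, fun z => (len_pair _ _).trans ?_⟩
    have h1 := (hc z).trans (pow_base_mono (n := len z) (by omega : c ≤ c + d))
    have h2 := (hd z).trans (pow_base_mono (n := len z) (by omega : d ≤ c + d))
    have h3 := max_le h1 h2
    rw [pow_succ]
    nlinarith
  | @limRon g h b _ _ _ hg _ hb =>
    obtain ⟨c, hc⟩ := hg
    obtain ⟨d, hd⟩ := hb
    refine ⟨c + d, fun z => ?_⟩
    cases hz : z.unpair.2 with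
    | zero =>
      simp only [hz]
      rw [limRonF]
      refine (hc _).trans ((Nat.pow_le_pow_left (by have := len_up1 z; omega) c).trans
        (pow_base_mono (by omega)))
    | succ y =>
      simp only [hz]
      rw [limRonF]
      refine (len_mono (min_le_right _ _)).trans ?_
      rw [← hz, Nat.pair_unpair]
      exact (hd z).trans (pow_base_mono (by omega))

/-! ### Recursion. -/

theorem PTF.rec' {g h : ℕ → ℕ} {R : ℕ → ℕ → ℕ} (hg : PTF g) (hh : PTF h)
    (R0 : ∀ x, R x 0 = g x)
    (R1 : ∀ x i, R x (i + 1) = h (Nat.pair x (Nat.pair (2 ^ i) (R x i))))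
    (hb : ∃ c, ∀ x i, len (R x i) ≤ (len x + i + 2) ^ c) :
    PTF (fun z => R z.unpair.1 (len z.unpair.2)) := by
  obtain ⟨c, hc⟩ := hb
  have hH : PTF (fun z => h (Nat.pair z.unpair.1 (Nat.pair (2 ^ len z.unpair.2.unpair.1 / 2)
      z.unpair.2.unpair.2))) :=
    hh.comp (PTF.up1.pairF (((PTF.up2.fst.powLen1).div' (PTF.const 2)).pairF PTF.up2.snd))
  have hB : PTF (fun z => 2 ^ (len (z * z * 16 + 16) ^ c)) :=
    (((PTF.id'.mul' PTF.id').mul' (PTF.const 16)).add' (PTF.const 16)).powLen c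
  refine (PTF.limRon hg hH hB).congr fun z => ?_
  generalize z.unpair.1 = x
  generalize z.unpair.2 = y
  induction y using Nat.strong_induction_on with
  | _ y ih =>
    cases y with
    | zero => rw [limRonF, len_zero, R0]
    | succ y =>
      rw [limRonF, ih _ (Nat.div_lt_self (Nat.succ_pos y) one_lt_two)]
      simp only [Nat.unpair_pair]
      rw [pow_len_pred, ← R1, len_div2]
      apply min_eq_left
      have := hc x (len (y + 1))
      refine (lt_pow_len _).le.trans (Nat.pow_le_pow_right (by norm_num) (this.trans ?_))
      apply Nat.pow_le_pow_left
      have h1 := len_pair_left x (y + 1)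
      have h2 := len_pair_right x (y + 1)
      have hp : 0 < len (y + 1) := len_pos (by omega)
      generalize hP : Nat.pair x (y + 1) = P at *
      have h3 : 2 * (len P - 1) + 4 < len (P * P * 16 + 16) := by
        rw [lt_len_iff]
        have : 2 ^ (len P - 1) ≤ P := lt_len_iff.1 (by omega)
        have e : 2 ^ (2 * (len P - 1) + 4) = 2 ^ (len P - 1) * 2 ^ (len P - 1) * 16 := by
          rw [pow_add, two_mul, pow_add]; norm_num
        have := Nat.mul_le_mul this this
        omega
      omega

end CLB


namespace CLB

/-! ### Normalizing circuit codes. -/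

/-- Reduce a gate at position `p` to an equivalent gate with a small code. -/
def redG (p g : ℕ) : ℕ :=
  Nat.pair (g.unpair.1 % 5)
    (if g.unpair.1 % 5 = 0 then g.unpair.2 % 2
     else if g.unpair.1 % 5 = 1 then g.unpair.2 % (p + 1)
     else if g.unpair.1 % 5 = 2 then min g.unpair.2 p
     else Nat.pair (min g.unpair.2.unpair.1 p) (min g.unpair.2.unpair.2 p))

theorem getD_min (l : List Bool) (a : ℕ) : l.getD (min a l.length) false = l.getD a false := by
  rcases le_total a l.length with h | h
  · rw [min_eq_left h]
  · rw [min_eq_right h, List.getD_eq_default _ _ le_rfl, List.getD_eq_default _ _ h]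

theorem gateEval_redG (x : ℕ → Bool) (prev : List Bool) (g : ℕ) :
    gateEval x prev (redG prev.length g) = gateEval x prev g := by
  unfold gateEval redG
  simp only [Nat.unpair_pair, Nat.mod_mod]
  have := Nat.mod_lt g.unpair.1 (show 5 > 0 by norm_num)
  split_ifs <;> simp [getD_min, -List.getD_eq_getElem?_getD]

theorem circEvalList_append (C : List ℕ) (g : ℕ) (x : ℕ → Bool) :
    circEvalList (C ++ [g]) x = circEvalList C x ++ [gateEval x (circEvalList C x) g] := by
  simp [circEvalList]

theorem circEvalList_length (C : List ℕ) (x : ℕ → Bool) : (circEvalList C x).length = C.length := by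
  induction C using List.reverseRecOn with
  | nil => rfl
  | append_singleton C g ih => rw [circEvalList_append]; simp [ih]

theorem circEvalList_red (C : List ℕ) (x : ℕ → Bool) :
    circEvalList (C.mapIdx redG) x = circEvalList C x := by
  induction C using List.reverseRecOn with
  | nil => rfl
  | append_singleton C g ih =>
    rw [List.mapIdx_append]
    simp only [List.mapIdx_cons, List.mapIdx_nil, Nat.zero_add]
    rw [circEvalList_append, circEvalList_append, ih, ← circEvalList_length C x, gateEval_redG]

/-! Parsing a number. -/

/-- Iterated parser step on states `(rest, acc, done)`. -/
def pStep (s : ℕ) : ℕ :=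
  let r := s.unpair.1
  let acc := s.unpair.2.unpair.1
  let done := s.unpair.2.unpair.2
  if done = 0 then
    if r ≤ 1 then Nat.pair 0 (Nat.pair acc 1)
    else if r % 2 = 0 then Nat.pair (r / 4) (Nat.pair acc 1)
    else Nat.pair (r / 4) (Nat.pair (2 * acc + r / 2 % 2) 0)
  else s

theorem bits_two (r : ℕ) (h : 2 ≤ r) :
    r.bits = decide (r % 2 = 1) :: decide (r / 2 % 2 = 1) :: (r / 4).bits := by
  have key : ∀ r : ℕ, 1 ≤ r → r.bits = decide (r % 2 = 1) :: (r / 2).bits := by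
    intro r hr
    have e : Nat.bit r.bodd r.div2 = r := Nat.bit_bodd_div2 r
    have h2 : r.div2 = 0 → r.bodd = true := by
      intro h0; rw [h0] at e; by_contra hb; simp at hb; rw [hb] at e; simp at e; omega
    rw [← Nat.div2_val]
    conv_lhs => rw [← e]
    rw [Nat.bits_append_bit _ _ h2]
    congr 1
    rw [Nat.mod_two_of_bodd]; cases r.bodd <;> simp
  rw [key r (by omega), key (r / 2) (by omega), Nat.div_div_eq_div_mul]

theorem pStep_iter_done (r acc i : ℕ) :
    pStep^[i] (Nat.pair r (Nat.pair acc 1)) = Nat.pair r (Nat.pair acc 1) := by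
  induction i with
  | zero => rfl
  | succ i ih => rw [Function.iterate_succ_apply]; simp [pStep, ih]

theorem pStep_spec (i : ℕ) : ∀ r acc, r + 1 < 2 ^ i → ∃ v r',
    pStep^[i] (Nat.pair r (Nat.pair acc 0)) = Nat.pair r' (Nat.pair v 1) ∧
      parseNum r.bits acc = (v, r'.bits) ∧ r' ≤ r / 4 := by
  induction i with
  | zero => intro r acc h; simp at h
  | succ i ih =>
    intro r acc h
    rw [pow_succ] at h
    rw [Function.iterate_succ_apply]
    by_cases h1 : r ≤ 1
    · refine ⟨acc, 0, ?_, ?_, by omega⟩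
      · simp [pStep, h1, pStep_iter_done]
      · interval_cases r <;> simp [parseNum]
    · rw [bits_two r (by omega)]
      by_cases h2 : r % 2 = 0
      · refine ⟨acc, r / 4, ?_, ?_, le_rfl⟩
        · simp [pStep, h1, h2, pStep_iter_done]
        · simp [parseNum, h2]
      · have h3 : r % 2 = 1 := by omega
        obtain ⟨v, r', e1, e2, e3⟩ := ih (r / 4) (2 * acc + r / 2 % 2) (by omega)
        refine ⟨v, r', ?_, ?_, by omega⟩
        · simp [pStep, h1, h3, e1]
        · simp only [parseNum, h3]
          rw [← e2]
          have : r / 2 % 2 = 0 ∨ r / 2 % 2 = 1 := by omega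
          rcases this with h | h <;> simp [h]

theorem PTF.iter {g h : ℕ → ℕ} (hg : PTF g) (hh : PTF h)
    (hb : ∃ c, ∀ x i, len ((fun s => h (Nat.pair x s))^[i] (g x)) ≤ (len x + i + 2) ^ c) :
    PTF (fun z => (fun s => h (Nat.pair z.unpair.1 s))^[len z.unpair.2] (g z.unpair.1)) := by
  have hH : PTF (fun z => h (Nat.pair z.unpair.1 z.unpair.2.unpair.2)) :=
    hh.comp (PTF.up1.pairF PTF.up2.snd)
  refine PTF.rec' (R := fun x i => (fun s => h (Nat.pair x s))^[i] (g x)) hg hH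
    (fun x => rfl) (fun x i => ?_) hb
  simp only [Nat.unpair_pair]
  rw [Function.iterate_succ_apply']

theorem PTF.pStep : PTF pStep := by
  have hr : PTF (fun s => s.unpair.1) := PTF.up1
  have ha : PTF (fun s => s.unpair.2.unpair.1) := PTF.up2.fst
  have hd : PTF (fun s => s.unpair.2.unpair.2) := PTF.up2.snd
  have h1 := (hr.leP (PTF.const 1)).ite ((PTF.const 0).pairF (ha.pairF (PTF.const 1)))
    ((hr.mod' (PTF.const 2)).ite' ((hr.div' (PTF.const 4)).pairF (ha.pairF (PTF.const 1)))
      ((hr.div' (PTF.const 4)).pairF ((((PTF.const 2).mul' ha).add'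
        ((hr.div' (PTF.const 2)).mod' (PTF.const 2))).pairF (PTF.const 0))))
  refine (hd.ite' h1 PTF.id').congr fun z => ?_
  unfold CLB.pStep
  congr

theorem pStep_bound (r i : ℕ) : ∃ r' a d, pStep^[i] (Nat.pair r (Nat.pair 0 0)) =
    Nat.pair r' (Nat.pair a d) ∧ r' ≤ r ∧ len a ≤ i ∧ d ≤ 1 := by
  induction i with
  | zero => exact ⟨r, 0, 0, rfl, le_rfl, by simp [len_zero], by simp⟩
  | succ i ih =>
    obtain ⟨r', a, d, e, h1, h2, h3⟩ := ih
    rw [Function.iterate_succ_apply', e]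
    simp only [pStep, Nat.unpair_pair]
    split_ifs
    · exact ⟨_, _, _, rfl, by omega, by omega, le_rfl⟩
    · exact ⟨_, _, _, rfl, by omega, by omega, le_rfl⟩
    · refine ⟨_, _, _, rfl, by omega, ?_, by omega⟩
      rw [len_le_iff] at *
      rw [pow_succ]
      omega
    · exact ⟨_, _, _, rfl, by omega, by omega, h3⟩

/-- The parser: `pair rest (pair value 1)`. -/
def pN (r : ℕ) : ℕ := pStep^[len r + 1] (Nat.pair r (Nat.pair 0 0))

theorem pN_spec (r : ℕ) : ∃ v r', pN r = Nat.pair r' (Nat.pair v 1) ∧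
    parseNum r.bits 0 = (v, r'.bits) ∧ r' ≤ r / 4 := by
  unfold pN
  refine pStep_spec (len r + 1) r 0 ?_
  have := lt_pow_len r
  rw [pow_succ]
  have : 1 ≤ 2 ^ len r := Nat.one_le_two_pow
  by_cases h : r = 0
  · subst h; simp [len_zero]
  · omega

theorem poly_aux (n i : ℕ) : 100 * (n + i + 2) ^ 2 ≤ (n + i + 2) ^ 9 := by
  have h : 2 ^ 7 ≤ (n + i + 2) ^ 7 := Nat.pow_le_pow_left (by omega) 7
  have e : (n + i + 2) ^ 9 = (n + i + 2) ^ 7 * (n + i + 2) ^ 2 := by rw [← pow_add]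
  rw [e]
  exact Nat.mul_le_mul_right _ (le_trans (by norm_num) h)

theorem PTF.pN : PTF pN := by
  have h := PTF.iter (g := fun x => Nat.pair x (Nat.pair 0 0)) (h := fun z => CLB.pStep z.unpair.2)
      (PTF.id'.pairF (PTF.const _)) (PTF.pStep.comp PTF.up2) ⟨9, fun x i => by
    simp only [Nat.unpair_pair]
    obtain ⟨r', a, d, e, h1, h2, h3⟩ := pStep_bound x i
    refine le_trans ?_ (poly_aux (len x) i)
    have e' : (fun s => CLB.pStep s)^[i] (Nat.pair x (Nat.pair 0 0)) = _ := e
    rw [e']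
    have := len_pair r' (Nat.pair a d)
    have := len_pair a d
    have := len_mono h1
    have := (len_le_self d).trans h3
    have h5 : len (Nat.pair r' (Nat.pair a d)) ≤ 100 * (len x + i + 2) := by omega
    refine h5.trans (Nat.mul_le_mul_left _ ?_)
    rw [pow_two]
    exact Nat.le_mul_self _⟩
  have h2 := h.comp (PTF.id'.pairF ((PTF.id').powLen1))
  refine h2.congr fun z => ?_
  simp only [Nat.unpair_pair, len_pow]
  unfold CLB.pN
  rfl

/-! Encoding numbers as bit lists. -/

def val (l : List Bool) : ℕ := l.foldr (fun b n => Nat.bit b n) 0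

theorem val_append (l l' : List Bool) : val (l ++ l') = val l + 2 ^ l.length * val l' := by
  induction l with
  | nil => simp [val]
  | cons b l ih =>
    have e : ∀ l, val (b :: l) = Nat.bit b (val l) := fun l => rfl
    rw [List.cons_append, e, e, ih, List.length_cons, pow_succ, Nat.bit_val, Nat.bit_val]
    ring

theorem val_bits_true (l : List Bool) : (val (l ++ [true])).bits = l ++ [true] := by
  induction l with
  | nil => simp [val]
  | cons b l ih =>
    have e : val (b :: l ++ [true]) = Nat.bit b (val (l ++ [true])) := rfl
    rw [e, Nat.bits_append_bit, ih]
    · rfl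
    · intro h0; rw [h0] at ih; simp at ih

def encV' (v : ℕ) : List Bool := v.bits.reverse.flatMap (fun b => [true, b])
def encV (v : ℕ) : List Bool := encV' v ++ [false, true]

theorem parse_flat (l rest : List Bool) : ∀ acc,
    parseNum (l.flatMap (fun b => [true, b]) ++ (false :: true :: rest)) acc =
      (l.foldl (fun n b => 2 * n + (cond b 1 0)) acc, rest) := by
  induction l with
  | nil => intro acc; simp [parseNum]
  | cons b l ih => intro acc; simp [parseNum, ih]

theorem foldl_bits (v : ℕ) : v.bits.reverse.foldl (fun n b => 2 * n + (cond b 1 0)) 0 = v := by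
  induction v using Nat.binaryRec' with
  | zero => simp
  | bit b n h ih =>
    rw [Nat.bits_append_bit _ _ h, List.reverse_cons, List.foldl_append, ih]
    cases b <;> simp [Nat.bit_val]

theorem parse_encV (v : ℕ) (rest : List Bool) : parseNum (encV v ++ rest) 0 = (v, rest) := by
  have := parse_flat v.bits.reverse rest 0
  rw [foldl_bits] at this
  simpa [encV, encV'] using this

theorem encV'_length (v : ℕ) : (encV' v).length = 2 * len v := by
  unfold encV'
  rw [List.length_flatMap]
  simp [len_eq_bits]; ring

theorem encV_length (v : ℕ) : (encV v).length = 2 * len v + 2 := by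
  simp [encV, encV'_length]

theorem bits_one (r : ℕ) (hr : 1 ≤ r) : r.bits = decide (r % 2 = 1) :: (r / 2).bits := by
  have e : Nat.bit r.bodd r.div2 = r := Nat.bit_bodd_div2 r
  have h2 : r.div2 = 0 → r.bodd = true := by
    intro h0; rw [h0] at e; by_contra hb; simp at hb; rw [hb] at e; simp at e; omega
  rw [← Nat.div2_val]
  conv_lhs => rw [← e]
  rw [Nat.bits_append_bit _ _ h2]
  congr 1
  rw [Nat.mod_two_of_bodd]; cases r.bodd <;> simp

theorem encV'_succ (y : ℕ) : val (encV' (y + 1)) =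
    val (encV' ((y + 1) / 2)) + 2 ^ (2 * len ((y + 1) / 2)) * (1 + 2 * ((y + 1) % 2)) := by
  have : encV' (y + 1) = encV' ((y + 1) / 2) ++ [true, decide ((y + 1) % 2 = 1)] := by
    unfold encV'
    rw [bits_one (y + 1) (by omega)]
    simp
  rw [this, val_append, encV'_length]
  congr 2
  have : (y + 1) % 2 = 0 ∨ (y + 1) % 2 = 1 := by omega
  rcases this with h | h <;> simp [h, val, Nat.bit_val]

theorem val_lt (l : List Bool) : val l < 2 ^ l.length := by
  induction l with
  | nil => simp [val]
  | cons b l ih =>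
    have e : val (b :: l) = Nat.bit b (val l) := rfl
    rw [e, Nat.bit_val, List.length_cons, pow_succ]
    cases b <;> simp <;> omega

theorem len_const3 : len 3 = 2 := by
  apply len_eq_of <;> norm_num

theorem PTF.encV' : PTF (fun v => val (encV' v)) := by
  have hh : PTF (fun z => z.unpair.2.unpair.2 + 2 ^ (len 3 * len (z.unpair.2.unpair.1 / 2)) *
      (1 + 2 * (z.unpair.2.unpair.1 % 2))) :=
    PTF.up2.snd.add' (((PTF.const 3).smash' (PTF.up2.fst.div' (PTF.const 2))).mul'
      ((PTF.const 1).add' ((PTF.const 2).mul' (PTF.up2.fst.mod' (PTF.const 2)))))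
  have hb : PTF (fun z => 2 ^ (len 3 * len z.unpair.2)) := (PTF.const 3).smash' PTF.up2
  have h := (PTF.limRon (PTF.const 0) hh hb).comp ((PTF.const 0).pairF PTF.id')
  refine h.congr fun y => ?_
  simp only [Nat.unpair_pair]
  induction y using Nat.strong_induction_on with
  | _ y ih =>
    cases y with
    | zero => rw [limRonF]; simp [CLB.encV', val]
    | succ y =>
      rw [limRonF, ih _ (Nat.div_lt_self (Nat.succ_pos y) one_lt_two)]
      simp only [Nat.unpair_pair]
      rw [len_const3, ← encV'_succ]
      apply min_eq_left
      have := val_lt (CLB.encV' (y + 1))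
      rw [encV'_length] at this
      exact this.le

theorem PTF.encV : PTF (fun v => val (encV v)) := by
  refine (PTF.encV'.add' (((PTF.const 3).smash' PTF.id').mul' (PTF.const 2))).congr fun v => ?_
  rw [CLB.encV, val_append, encV'_length, len_const3]
  simp [val, Nat.bit_val]

theorem PTF.redG {f g : ℕ → ℕ} (hf : PTF f) (hg : PTF g) : PTF (fun z => redG (f z) (g z)) := by
  have hmin : ∀ {f g : ℕ → ℕ}, PTF f → PTF g → PTF (fun z => min (f z) (g z)) := by
    intro f g hf hg
    refine (hf.sub' (hf.sub' hg)).congr fun z => by omega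
  have ht := hg.fst.mod' (PTF.const 5)
  have h4 := (hmin hg.snd.fst hf).pairF (hmin hg.snd.snd hf)
  have h3 := (ht.eqP (PTF.const 2)).ite (hmin hg.snd hf) h4
  have h2 := (ht.eqP (PTF.const 1)).ite (hg.snd.mod' (hf.add' (PTF.const 1))) h3
  have h1 := (ht.eqP (PTF.const 0)).ite (hg.snd.mod' (PTF.const 2)) h2
  refine (ht.pairF h1).congr fun z => ?_
  unfold CLB.redG
  congr

end CLB


namespace CLB

theorem parseNum_len (n : ℕ) : ∀ l acc, l.length ≤ n → l ≠ [] →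
    (parseNum l acc).2.length < l.length := by
  induction n with
  | zero => intro l acc h h0; exact absurd (List.length_eq_zero_iff.1 (by omega)) h0
  | succ n ih =>
    intro l acc h h0
    match l, h with
    | [], _ => exact absurd rfl h0
    | [_], _ => simp [parseNum]
    | b :: c :: rest, h =>
      simp only [List.length_cons] at h ⊢
      cases b
      · simp [parseNum]
      · simp only [parseNum, if_true]
        by_cases hr : rest = []
        · subst hr; simp [parseNum]
        · have := ih rest (2 * acc + (cond c 1 0)) (by omega) hr
          omega

theorem decodeLN_cons (f : ℕ) (l : List Bool) (h : l ≠ []) :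
    decodeLN (f + 1) l = (parseNum l 0).1 :: decodeLN f (parseNum l 0).2 := by
  cases l with
  | nil => exact absurd rfl h
  | cons b l => rfl

theorem decodeLN_nil (f : ℕ) : decodeLN f [] = [] := by cases f <;> rfl

theorem decodeLN_fuel (f : ℕ) : ∀ f' l, l.length ≤ f → l.length ≤ f' →
    decodeLN f l = decodeLN f' l := by
  induction f with
  | zero =>
    intro f' l h _
    have : l = [] := List.length_eq_zero_iff.1 (by omega)
    subst this; rw [decodeLN_nil, decodeLN_nil]
  | succ f ih =>
    intro f' l h h'
    by_cases hl : l = []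
    · subst hl; rw [decodeLN_nil, decodeLN_nil]
    · have h3 := parseNum_len _ l 0 le_rfl hl
      have : 0 < l.length := List.length_pos_iff.2 hl
      obtain ⟨f'', rfl⟩ : ∃ f'', f' = f'' + 1 := ⟨f' - 1, by omega⟩
      rw [decodeLN_cons _ _ hl, decodeLN_cons _ _ hl, ih f'' _ (by omega) (by omega)]

theorem bits_ne_nil {r : ℕ} (h : r ≠ 0) : r.bits ≠ [] := by
  intro h0
  have := len_eq_bits r
  rw [h0] at this
  have := len_pos (Nat.pos_of_ne_zero h)
  simp at *
  omega

theorem cDecode_step {r v r' : ℕ} (hr : r ≠ 0) (h : parseNum r.bits 0 = (v, r'.bits)) :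
    cDecode r = v :: cDecode r' := by
  unfold cDecode
  have h3 := parseNum_len _ r.bits 0 le_rfl (bits_ne_nil hr)
  rw [h] at h3
  simp only at h3
  obtain ⟨f, hf⟩ : ∃ f, r.bits.length = f + 1 := ⟨r.bits.length - 1, by omega⟩
  rw [hf, decodeLN_cons _ _ (bits_ne_nil hr), h]
  simp only
  rw [decodeLN_fuel f r'.bits.length _ (by omega) le_rfl]

def EL (gs : List ℕ) : List Bool := gs.flatMap encV

theorem encV_ne_nil (v : ℕ) (l : List Bool) : encV v ++ l ≠ [] := by simp [encV]

theorem decode_EL (gs : List ℕ) : ∀ f, (EL gs).length ≤ f → decodeLN f (EL gs) = gs := by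
  induction gs with
  | nil => intro f _; exact decodeLN_nil f
  | cons g gs ih =>
    intro f hf
    have e : EL (g :: gs) = encV g ++ EL gs := rfl
    rw [e] at hf ⊢
    rw [List.length_append, encV_length] at hf
    obtain ⟨f', rfl⟩ : ∃ f', f = f' + 1 := ⟨f - 1, by omega⟩
    rw [decodeLN_cons _ _ (encV_ne_nil _ _), parse_encV]
    simp only
    rw [ih f' (by omega)]

theorem EL_append (gs : List ℕ) (g : ℕ) : EL (gs ++ [g]) = EL gs ++ encV g := by simp [EL]

theorem bits_EL (gs : List ℕ) : (val (EL gs)).bits = EL gs := by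
  induction gs using List.reverseRecOn with
  | nil => simp [EL, val]
  | append_singleton gs g _ =>
    have : EL (gs ++ [g]) = (EL gs ++ encV' g ++ [false]) ++ [true] := by
      rw [EL_append]; simp [encV]
    rw [this, val_bits_true]

theorem len_EL (gs : List ℕ) : len (val (EL gs)) = (EL gs).length := by
  rw [← len_eq_bits, bits_EL]

theorem cDecode_EL (gs : List ℕ) : cDecode (val (EL gs)) = gs := by
  unfold cDecode
  rw [bits_EL]
  exact decode_EL gs _ le_rfl

/-- One step of the normalisation loop on states `(rest, position, output)`. -/
def nStep (s : ℕ) : ℕ :=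
  if s.unpair.1 = 0 then s
  else Nat.pair (pN s.unpair.1).unpair.1 (Nat.pair (s.unpair.2.unpair.1 + 1)
    (s.unpair.2.unpair.2 + 2 ^ len s.unpair.2.unpair.2 *
      val (encV (redG s.unpair.2.unpair.1 (pN s.unpair.1).unpair.2.unpair.1))))

theorem PTF.nStep : PTF nStep := by
  have hp := PTF.pN.comp PTF.up1
  have h := PTF.up1.ite' PTF.id' (hp.fst.pairF ((PTF.up2.fst.add' (PTF.const 1)).pairF
    (PTF.up2.snd.add' (PTF.up2.snd.powLen1.mul' (PTF.encV.comp (PTF.redG PTF.up2.fst hp.snd.fst))))))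
  exact h.congr fun z => by unfold CLB.nStep; rfl

theorem nStep_spec (C i : ℕ) : ∃ r G,
    nStep^[i] (Nat.pair C (Nat.pair 0 0)) =
      Nat.pair r (Nat.pair G.length (val (EL (G.mapIdx redG)))) ∧
    cDecode C = G ++ cDecode r ∧ G.length ≤ i ∧ r ≤ C / 2 ^ i := by
  induction i with
  | zero => exact ⟨C, [], by simp [EL, val], by simp, by simp, by simp⟩
  | succ i ih =>
    obtain ⟨r, G, e1, e2, e3, e4⟩ := ih
    rw [Function.iterate_succ_apply', e1]
    by_cases hr : r = 0
    · refine ⟨r, G, ?_, e2, by omega, hr ▸ Nat.zero_le _⟩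
      simp [nStep, hr]
    · obtain ⟨v, r', f1, f2, f3⟩ := pN_spec r
      refine ⟨r', G ++ [v], ?_, ?_, by simp; omega, ?_⟩
      · simp only [nStep, Nat.unpair_pair, if_neg hr, f1]
        rw [List.mapIdx_append]
        simp only [List.mapIdx_cons, List.mapIdx_nil, Nat.zero_add]
        rw [EL_append, val_append, len_EL, List.length_append, List.length_singleton]
      · rw [e2, cDecode_step hr f2]; simp
      · rw [pow_succ, ← Nat.div_div_eq_div_mul]
        omega

theorem len_redG (p g : ℕ) : len (redG p g) ≤ 4 * p + 6 := by
  unfold redG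
  refine (len_pair _ _).trans ?_
  have h5 := Nat.mod_lt g.unpair.1 (show 5 > 0 by norm_num)
  have h3 : len (g.unpair.1 % 5) ≤ 3 := len_le_iff.2 (by omega)
  have hp := len_le_self p
  have hw : len (if g.unpair.1 % 5 = 0 then g.unpair.2 % 2
     else if g.unpair.1 % 5 = 1 then g.unpair.2 % (p + 1)
     else if g.unpair.1 % 5 = 2 then min g.unpair.2 p
     else Nat.pair (min g.unpair.2.unpair.1 p) (min g.unpair.2.unpair.2 p)) ≤ 2 * p + 3 := by
    split_ifs
    · have : len (g.unpair.2 % 2) ≤ 1 := len_le_iff.2 (by omega)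
      omega
    · have : g.unpair.2 % (p + 1) ≤ p := Nat.lt_succ_iff.1 (Nat.mod_lt _ (Nat.succ_pos p))
      have := len_mono this
      omega
    · have := len_mono (min_le_right g.unpair.2 p)
      omega
    · have := len_mono (min_le_right g.unpair.2.unpair.1 p)
      have := len_mono (min_le_right g.unpair.2.unpair.2 p)
      have := len_pair (min g.unpair.2.unpair.1 p) (min g.unpair.2.unpair.2 p)
      omega
  omega

theorem EL_len (G : List ℕ) : (EL (G.mapIdx redG)).length ≤ 14 * G.length ^ 2 := by
  induction G using List.reverseRecOn with
  | nil => simp [EL]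
  | append_singleton G g ih =>
    rw [List.mapIdx_append]
    simp only [List.mapIdx_cons, List.mapIdx_nil, Nat.zero_add]
    rw [EL_append, List.length_append, encV_length, List.length_append, List.length_singleton]
    have := len_redG G.length g
    nlinarith

def normC (C : ℕ) : ℕ := (nStep^[len C] (Nat.pair C (Nat.pair 0 0))).unpair.2.unpair.2

theorem normC_eq (C : ℕ) : normC C = val (EL ((cDecode C).mapIdx redG)) := by
  obtain ⟨r, G, e1, e2, e3, e4⟩ := nStep_spec C (len C)
  have : r = 0 := by
    rw [Nat.div_eq_of_lt (lt_pow_len C)] at e4; omega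
  subst this
  unfold normC
  rw [e1, e2]
  simp [cDecode, decodeLN]

theorem cEval_normC (C x : ℕ) : cEval (normC C) x = cEval C x := by
  unfold cEval
  rw [normC_eq, cDecode_EL]
  unfold circEval
  rw [circEvalList_red]

theorem len_normC (C : ℕ) : len (normC C) ≤ 14 * csize C ^ 2 := by
  rw [normC_eq, len_EL]
  exact EL_len _

theorem PTF.normC : PTF normC := by
  have h := PTF.iter (g := fun x => Nat.pair x (Nat.pair 0 0)) (h := fun z => CLB.nStep z.unpair.2)
      (PTF.id'.pairF (PTF.const _)) (PTF.nStep.comp PTF.up2) ⟨9, fun x i => by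
    simp only [Nat.unpair_pair]
    obtain ⟨r, G, e1, e2, e3, e4⟩ := nStep_spec x i
    refine le_trans ?_ (poly_aux (len x) i)
    have e' : (fun s => CLB.nStep s)^[i] (Nat.pair x (Nat.pair 0 0)) = _ := e1
    rw [e']
    have a1 := len_pair r (Nat.pair G.length (val (EL (G.mapIdx CLB.redG))))
    have a2 := len_pair G.length (val (EL (G.mapIdx CLB.redG)))
    have a3 := len_mono (e4.trans (Nat.div_le_self _ _))
    have a4 := len_le_self G.length
    have a5 := EL_len G
    rw [← len_EL] at a5
    have a6 : G.length ^ 2 ≤ (len x + i + 2) ^ 2 := Nat.pow_le_pow_left (by omega) 2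
    have a7 : len x + i + 2 ≤ (len x + i + 2) ^ 2 := by
      rw [pow_two]
      exact Nat.le_mul_self _
    omega⟩
  have h2 := (h.comp (PTF.id'.pairF PTF.id')).snd.snd
  refine h2.congr fun z => ?_
  simp only [Nat.unpair_pair]
  unfold CLB.normC
  rfl

end CLB


namespace CLB

/-! ### Games -/

def Good (k : ℕ) (g : ℕ → ℕ) (y q x : ℕ) : Prop :=
  len y ≤ len q.unpair.1 ∧ csize q.unpair.2 ≤ len q.unpair.1 ^ k ∧
    (len x = len q.unpair.1 → (g x = 1 ↔ cEval q.unpair.2 x = 1))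

def Win (k : ℕ) (g : ℕ → ℕ) : List (ℕ → ℕ) → ℕ → ℕ → Prop
  | [], _, _ => False
  | c :: cs, y, h => ∀ x, Good k g y (c h) x ∨ Win k g cs y (Nat.pair h x)

theorem PTP.good (k : ℕ) {g y q x : ℕ → ℕ} (hg : PTF g) (hy : PTF y) (hq : PTF q) (hx : PTF x) :
    PTP (fun z => Good k g (y z) (q z) (x z)) := by
  have hpow : PTF (fun z => len (q z).unpair.1 ^ k) := by
    refine ((hq.fst.powLen k).len'.sub' (PTF.const 1)).congr fun z => ?_
    rw [len_pow]; rfl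
  exact (hy.len'.leP hq.fst.len').and (((PTF.csizeB.comp hq.snd).leP hpow).and
    ((hx.len'.eqP hq.fst.len').imp
      (((hg.comp hx).eqP (PTF.const 1)).iff ((hq.snd.cEval' hx).eqP (PTF.const 1)))))

theorem lemma_d (k : ℕ) {g t : ℕ → ℕ} (hg : PTF g) (ht : PTF t) (cs : List (ℕ → ℕ))
    (hcs : ∀ c ∈ cs, PTF c) : ∀ h : ℕ → ℕ, PTF h → ∃ d, PTF d ∧
      ∀ y, Win k g cs y (h y) → Good k g y (d y) (t (d y)) := by
  classical
  induction cs with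
  | nil => intro h _; exact ⟨fun z => z, PTF.id', fun y hy => hy.elim⟩
  | cons c cs ih =>
    intro h hh
    have hq : PTF (fun y => c (h y)) := (hcs c (by simp)).comp hh
    obtain ⟨d', hd', h2⟩ := ih (fun c hc => hcs c (by simp [hc]))
      (fun y => Nat.pair (h y) (t (c (h y)))) (hh.pairF (ht.comp hq))
    refine ⟨_, (PTP.good k hg PTF.id' hq (ht.comp hq)).ite hq hd', fun y hy => ?_⟩
    split_ifs with hG
    · exact hG
    · exact h2 y ((hy (t (c (h y)))).resolve_left hG)

/-! ### Building blocks -/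

def top (x : ℕ) : ℕ := 2 ^ len x / 2

theorem PTF.top {f : ℕ → ℕ} (hf : PTF f) : PTF (fun z => top (f z)) :=
  (hf.powLen1).div' (PTF.const 2)

theorem top_eq {x m : ℕ} (h : len x = m + 1) : top x = 2 ^ m := by
  unfold top; rw [h, pow_succ]; simp

theorem len_top_add {m w : ℕ} (h : w < 2 ^ m) : len (2 ^ m + w) = m + 1 := by
  apply len_eq_of
  · omega
  · rw [pow_succ]; omega

/-- `Σ_{u<i} D(a+u) 2^u`. -/
def RecF (p : ℕ) : ℕ → ℕ
  | 0 => 0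
  | i + 1 => RecF p i + cEval p.unpair.1 (p.unpair.2 + i) * 2 ^ i

theorem RecF_lt (p i : ℕ) : RecF p i < 2 ^ i := by
  induction i with
  | zero => simp [RecF]
  | succ i ih =>
    have h := cEval_le p.unpair.1 (p.unpair.2 + i)
    have := Nat.mul_le_mul_right (2 ^ i) h
    rw [RecF, pow_succ]; omega

theorem PTF.RecF : PTF (fun z => RecF z.unpair.1 (len z.unpair.2)) := by
  have hi : PTF (fun z => z.unpair.2.unpair.1) := PTF.up2.fst
  refine PTF.rec' (R := CLB.RecF) (PTF.const 0)
    (PTF.up2.snd.add' ((PTF.up1.fst.cEval' (PTF.up1.snd.add' (hi.len'.sub' (PTF.const 1)))).mul' hi))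
    (fun x => rfl) (fun x i => ?_) ⟨1, fun x i => ?_⟩
  · simp only [Nat.unpair_pair, len_pow, Nat.add_sub_cancel]
    rfl
  · have := len_le_iff.2 (RecF_lt x i)
    rw [pow_one]; omega

theorem RecF_eq (p E B : ℕ) (h : ∀ u < B, E / 2 ^ u % 2 = cEval p.unpair.1 (p.unpair.2 + u)) :
    RecF p B = E % 2 ^ B := by
  induction B with
  | zero => simp [RecF, Nat.mod_one]
  | succ B ih =>
    rw [RecF, ih (fun u hu => h u (by omega)), ← h B (by omega), Nat.mod_pow_succ]
    ring

def pwF (u : ℕ) : ℕ → ℕ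
  | 0 => 1
  | i + 1 => if len (pwF u i) ≤ u then 2 * pwF u i else pwF u i

theorem pwF_eq (u i : ℕ) : pwF u i = 2 ^ min i u := by
  induction i with
  | zero => simp [pwF]
  | succ i ih =>
    rw [pwF, ih, len_pow]
    split_ifs with h
    · have e1 : min i u = i := by omega
      have e2 : min (i + 1) u = i + 1 := by omega
      rw [e1, e2, pow_succ]; ring
    · congr 1; omega

theorem PTF.bitAt {f g : ℕ → ℕ} (hf : PTF f) (hg : PTF g) :
    PTF (fun z => f z / 2 ^ g z % 2) := by
  have h : PTF (fun z => pwF z.unpair.1 (len z.unpair.2)) := by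
    refine PTF.rec' (R := CLB.pwF) (PTF.const 1)
      ((PTF.up2.snd.len'.leP PTF.up1).ite ((PTF.const 2).mul' PTF.up2.snd) PTF.up2.snd)
      (fun x => rfl) (fun x i => ?_) ⟨1, fun x i => ?_⟩
    · simp only [Nat.unpair_pair]
      rw [pwF]
    · rw [pwF_eq, len_pow, pow_one]; omega
  refine ((hf.div' (h.comp (hg.pairF hf))).mod' (PTF.const 2)).congr fun z => ?_
  simp only [Nat.unpair_pair, pwF_eq]
  rcases le_total (g z) (len (f z)) with h | h
  · rw [min_eq_right h]
  · rw [min_eq_left h, Nat.div_eq_of_lt (lt_pow_len _), Nat.div_eq_of_lt]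
    exact (lt_pow_len _).trans_le (Nat.pow_le_pow_right (by norm_num) h)

open Classical in
noncomputable def fd (P : ℕ → Prop) : ℕ → ℕ
  | 0 => 0
  | i + 1 => if P (fd P i) then fd P i + 1 else fd P i

theorem fd_spec (P : ℕ → Prop) (i : ℕ) :
    fd P i ≤ i ∧ (∀ u < fd P i, P u) ∧ (fd P i < i → ¬ P (fd P i)) := by
  induction i with
  | zero => simp [fd]
  | succ i ih =>
    obtain ⟨h1, h2, h3⟩ := ih
    rw [fd]
    split_ifs with h
    · refine ⟨by omega, fun u hu => ?_, fun hl => ?_⟩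
      · rcases Nat.lt_succ_iff_lt_or_eq.1 hu with h' | h'
        · exact h2 u h'
        · exact h' ▸ h
      · exact absurd h (h3 (by omega))
    · exact ⟨by omega, h2, fun _ => h⟩

theorem PTF.fd {P : ℕ → ℕ → Prop} (hP : PTP (fun z => P z.unpair.1 z.unpair.2)) :
    PTF (fun z => fd (P z.unpair.1) (len z.unpair.2)) := by
  classical
  have h := (hP.ite ((PTF.up2).add' (PTF.const 1)) PTF.up2).comp
    (PTF.up1.pairF (PTF.up2.snd))
  refine PTF.rec' (R := fun x i => CLB.fd (P x) i) (PTF.const 0) h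
    (fun x => rfl) (fun x i => ?_) ⟨1, fun x i => ?_⟩
  · simp only [Nat.unpair_pair]
    rw [CLB.fd]
  · have := (fd_spec (P x) i).1
    have := len_le_self (CLB.fd (P x) i)
    rw [pow_one]; omega

theorem poly_exp (c : ℕ) : ∃ m0, ∀ m, m0 ≤ m → (m + 3) ^ c ≤ 2 ^ m := by
  have h := tendsto_pow_const_div_const_pow_of_one_lt c (show (1 : ℝ) < 2 by norm_num)
  have h2 := h.eventually (gt_mem_nhds (show (0 : ℝ) < 1 / 8 by norm_num))
  obtain ⟨m0, hm⟩ := Filter.eventually_atTop.1 h2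
  refine ⟨m0, fun m hmm => ?_⟩
  have := hm (m + 3) (by omega)
  rw [div_lt_iff₀ (by positivity)] at this
  have h3 : ((m + 3 : ℕ) : ℝ) ^ c < 2 ^ m := by
    rw [pow_add] at this
    linarith
  have h4 : (((m + 3) ^ c : ℕ) : ℝ) < ((2 ^ m : ℕ) : ℝ) := by push_cast at h3 ⊢; exact h3
  exact_mod_cast h4.le

/-! ### The hard function and the stage lemma -/

def gHard (k x : ℕ) : ℕ :=
  1 - cEval (RecF (x - top x) (len (2 ^ (len x ^ (2 * k + 2))))) x

theorem PTF.gHard (k : ℕ) : PTF (gHard k) := by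
  have h := PTF.RecF.comp ((PTF.id'.sub' (PTF.top PTF.id')).pairF (PTF.id'.powLen (2 * k + 2)))
  refine ((PTF.const 1).sub' (h.cEval' PTF.id')).congr fun z => ?_
  simp only [Nat.unpair_pair]
  rfl

theorem bit_iff {A B : ℕ} (hA : A < 2) (hB : B ≤ 1) (h : A = 1 ↔ B = 1) : A = B := by omega

theorem stage (k : ℕ) (hyp : ∀ g, PTF g → ∃ cs : List (ℕ → ℕ), (∀ c ∈ cs, PTF c) ∧
      ∀ y, Win k g cs y y) {q : ℕ → ℕ} (Y : ℕ → ℕ) (hq : PTF q) (hY : ∀ z, len z ≤ len (Y z)) :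
    ∃ u x, PTF u ∧ PTF x ∧ (∀ z, len z ≤ len (u z)) ∧
      ∀ z, ¬ Good k (gHard k) (Y (u z)) (q (u z)) (x z) := by
  set K := 2 * k + 2 with hK
  -- the functions involved
  have hU : PTF (fun a => 2 ^ (len a ^ K)) := PTF.id'.powLen K
  set U : ℕ → ℕ := fun a => 2 ^ (len a ^ K) with hUd
  have hz1 : PTF (fun a => (q (U a)).unpair.1) := (hq.comp hU).fst
  set z1 : ℕ → ℕ := fun a => (q (U a)).unpair.1 with hz1d
  have hE : PTF (fun a => normC (q (U a)).unpair.2) := PTF.normC.comp (hq.comp hU).snd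
  set E : ℕ → ℕ := fun a => normC (q (U a)).unpair.2 with hEd
  have hB : PTF (fun a => 2 ^ (len (z1 a) ^ K)) := hz1.powLen K
  -- the language
  have hL : PTF (fun x => E (top x) / 2 ^ (x - top x) % 2) :=
    PTF.bitAt (hE.comp (PTF.top PTF.id')) (PTF.id'.sub' (PTF.top PTF.id'))
  set L : ℕ → ℕ := fun x => E (top x) / 2 ^ (x - top x) % 2 with hLd
  -- the teacher
  have hP : PTP (fun z => E (top z.unpair.1.unpair.1) / 2 ^ z.unpair.2 % 2 =
      cEval z.unpair.1.unpair.2 (top z.unpair.1.unpair.1 + z.unpair.2)) :=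
    (PTF.bitAt (hE.comp (PTF.top PTF.up1.fst)) PTF.up2).eqP
      (PTF.up1.snd.cEval' ((PTF.top PTF.up1.fst).add' PTF.up2))
  set P : ℕ → ℕ → Prop := fun v u => E (top v.unpair.1) / 2 ^ u % 2 =
      cEval v.unpair.2 (top v.unpair.1 + u) with hPd
  have hfd := PTF.fd (P := P) hP
  have ht : PTF (fun v => top v.unpair.1 + fd (P v) (len (2 ^ (len (z1 (top v.unpair.1)) ^ K)))) := by
    refine ((PTF.top PTF.up1).add' (hfd.comp (PTF.id'.pairF (hB.comp (PTF.top PTF.up1))))).congr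
      fun v => ?_
    simp only [Nat.unpair_pair]
  set t : ℕ → ℕ := fun v => top v.unpair.1 + fd (P v) (len (2 ^ (len (z1 (top v.unpair.1)) ^ K)))
    with htd
  obtain ⟨cs, hcs, hwin⟩ := hyp L hL
  obtain ⟨d, hd, hgood⟩ := lemma_d k hL ht cs hcs (fun z => z) PTF.id'
  obtain ⟨c, hc⟩ := hB.growth
  obtain ⟨m0, hm0⟩ := poly_exp c
  have hdm : PTF (fun z => d (z + 2 ^ (m0 + 30))) := hd.comp (PTF.id'.add' (PTF.const _))
  have ha : PTF (fun z => top (d (z + 2 ^ (m0 + 30))).unpair.1) := PTF.top hdm.fst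
  refine ⟨fun z => U (top (d (z + 2 ^ (m0 + 30))).unpair.1),
    fun z => top (z1 (top (d (z + 2 ^ (m0 + 30))).unpair.1)) +
      Nat.pair (normC (d (z + 2 ^ (m0 + 30))).unpair.2) (top (d (z + 2 ^ (m0 + 30))).unpair.1),
    hU.comp ha, (PTF.top (hz1.comp ha)).add' ((PTF.normC.comp hdm.snd).pairF ha), ?_⟩
  rw [← forall_and]
  intro z
  have hG := hgood _ (hwin (z + 2 ^ (m0 + 30)))
  set v := d (z + 2 ^ (m0 + 30)) with hv
  set D := v.unpair.2 with hD
  obtain ⟨g1, g2, g3⟩ := hG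
  have hm' : m0 + 30 + 1 ≤ len v.unpair.1 := by
    refine le_trans ?_ g1
    rw [← len_pow]; exact len_mono (Nat.le_add_left _ _)
  have hzm : len z ≤ len v.unpair.1 := le_trans (len_mono (Nat.le_add_right _ _)) g1
  obtain ⟨m, hm⟩ : ∃ m, len v.unpair.1 = m + 1 := ⟨len v.unpair.1 - 1, by omega⟩
  have hta : top v.unpair.1 = 2 ^ m := top_eq hm
  set a := top v.unpair.1 with had
  have hla : len a = m + 1 := by rw [hta, len_pow]
  have hUa : len (U a) = (m + 1) ^ K + 1 := by rw [hUd]; simp only; rw [len_pow, hla]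
  have hmK : m + 1 ≤ (m + 1) ^ K := Nat.le_self_pow (by omega) _
  refine ⟨by rw [hUa]; omega, ?_⟩
  -- the circuit `D` describes `E a`
  have hBm : len (2 ^ (len (z1 a) ^ K)) ≤ 2 ^ m := by
    have := hc a
    rw [hla] at this
    exact this.trans (hm0 m (by omega))
  obtain ⟨f1, f2, f3⟩ := fd_spec (P v) (len (2 ^ (len (z1 a) ^ K)))
  have hall : ∀ u < len (2 ^ (len (z1 a) ^ K)), E a / 2 ^ u % 2 = cEval D (a + u) := by
    by_cases hlt : fd (P v) (len (2 ^ (len (z1 a) ^ K))) < len (2 ^ (len (z1 a) ^ K))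
    · exfalso
      have hn := f3 hlt
      set u := fd (P v) (len (2 ^ (len (z1 a) ^ K))) with hu
      have htv : t v = 2 ^ m + u := by rw [htd]; simp only; rw [← had, ← hu, hta]
      have hlt' : len (t v) = m + 1 := by rw [htv]; exact len_top_add (by omega)
      have h4 := g3 (by rw [hlt', hm])
      have hLt : L (t v) = E a / 2 ^ u % 2 := by
        rw [hLd]; simp only
        rw [top_eq hlt', htv, Nat.add_sub_cancel_left, ← hta]
      have h8 := cEval_le D (t v)
      have hl2 : L (t v) < 2 := Nat.mod_lt _ (by norm_num)
      have e1 : L (t v) = cEval D (t v) := bit_iff hl2 h8 h4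
      apply hn
      change E a / 2 ^ u % 2 = cEval D (a + u)
      rw [← hLt, show a + u = t v by rw [htv, hta] ]
      exact e1
    · intro u hu
      exact f2 u (by omega)
  -- now refute
  rintro ⟨k1, k2, k3⟩
  have hm1 : (m + 1) ^ K + 1 ≤ len (z1 a) := (hUa ▸ hY (U a)).trans k1
  obtain ⟨m1, hm1e⟩ : ∃ m1, len (z1 a) = m1 + 1 := ⟨len (z1 a) - 1, by omega⟩
  have k2' : csize (q (U a)).unpair.2 ≤ (m1 + 1) ^ k := hm1e ▸ k2
  have key : ∀ n C, 30 ≤ n → csize C ≤ n ^ k → 2 * len (normC C) ≤ n ^ K := by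
    intro n C hn hC
    have h1 := len_normC C
    have h2 : csize C ^ 2 ≤ (n ^ k) ^ 2 := Nat.pow_le_pow_left hC 2
    have h3 : n ^ K = (n ^ k) ^ 2 * (n * n) := by rw [hK]; ring
    have h4 : 30 * 1 ≤ n * n := Nat.mul_le_mul hn (by omega)
    have h5 := Nat.mul_le_mul_left ((n ^ k) ^ 2) h4
    rw [h3]; omega
  have hpair : Nat.pair (normC D) a < 2 ^ m1 := by
    have h1 := len_pair (normC D) a
    have h2 := key (m + 1) D (by omega) (hm ▸ g2)
    have h3 : 2 * (m + 1) ≤ (m + 1) ^ K := by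
      calc 2 * (m + 1) ≤ (m + 1) * (m + 1) := Nat.mul_le_mul_right _ (by omega)
        _ = (m + 1) ^ 2 := by ring
        _ ≤ _ := Nat.pow_le_pow_right (by omega) (by omega)
    rw [hla] at h1
    apply len_le_iff.1
    omega
  have k3 : len (top (z1 a) + Nat.pair (normC D) a) = len (z1 a) →
    (gHard k (top (z1 a) + Nat.pair (normC D) a) = 1 ↔
      cEval (q (U a)).unpair.2 (top (z1 a) + Nat.pair (normC D) a) = 1) := k3
  rw [top_eq hm1e] at k3
  set x := 2 ^ m1 + Nat.pair (normC D) a with hx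
  have hlx : len x = m1 + 1 := len_top_add hpair
  have h5 := k3 (by rw [hlx]; exact hm1e.symm)
  have hRec : RecF (x - top x) (len (2 ^ (len x ^ (2 * k + 2)))) = E a := by
    rw [top_eq hlx, hx, Nat.add_sub_cancel_left, ← hx, hlx, ← hm1e]
    rw [RecF_eq _ (E a)]
    · apply Nat.mod_eq_of_lt
      apply len_le_iff.1
      have := key (m1 + 1) _ (by omega) k2'
      rw [len_pow, hm1e]
      have e : len (E a) = len (normC (q (U a)).unpair.2) := rfl
      rw [e]
      refine le_trans ?_ (this.trans (Nat.le_succ _))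
      rw [two_mul]
      exact Nat.le_add_left _ _
    · intro u hu
      simp only [Nat.unpair_pair, cEval_normC]
      exact hall u hu
  have hE2 : cEval (E a) x = cEval (q (U a)).unpair.2 x := cEval_normC _ _
  have h6 : gHard k x = 1 - cEval (q (U a)).unpair.2 x := by
    unfold gHard; rw [hRec, hE2]
  have h7 := cEval_le (q (U a)).unpair.2 x
  rw [h6] at h5
  omega

theorem no_win (k : ℕ) (hyp : ∀ g, PTF g → ∃ cs : List (ℕ → ℕ), (∀ c ∈ cs, PTF c) ∧
      ∀ y, Win k g cs y y) (cs : List (ℕ → ℕ)) (hcs : ∀ c ∈ cs, PTF c) :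
    ∀ H Y : ℕ → ℕ, PTF H → (∀ z, len z ≤ len (Y z)) →
      ¬ ∀ z, Win k (gHard k) cs (Y z) (H z) := by
  induction cs with
  | nil => intro H Y _ _ h; exact h 0
  | cons c cs ih =>
    intro H Y hH hY h
    obtain ⟨u, x, hu, hx, h1, h2⟩ := stage k hyp (q := fun z => c (H z)) Y
      ((hcs c (by simp)).comp hH) hY
    refine ih (fun c hc => hcs c (by simp [hc])) (fun z => Nat.pair (H (u z)) (x z))
      (fun z => Y (u z)) ((hH.comp hu).pairF hx) (fun z => (h1 z).trans (hY _)) fun z => ?_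
    exact ((h (u z)) (x z)).resolve_left (h2 z)

theorem contra (k : ℕ) : ¬ ∀ g, PTF g → ∃ cs : List (ℕ → ℕ), (∀ c ∈ cs, PTF c) ∧
      ∀ y, Win k g cs y y := by
  intro hyp
  obtain ⟨cs, hcs, h⟩ := hyp (gHard k) (PTF.gHard k)
  exact no_win k hyp cs hcs (fun z => z) (fun z => z) PTF.id' (fun z => le_rfl) h

end CLB


open FirstOrder FirstOrder.Language

namespace CLB

/-! ### Countability of the class of polynomial-time functions -/

def baseSet : Set (ℕ → ℕ) :=
  ({(fun z => z), (fun z => z.unpair.1), (fun z => z.unpair.2), (fun z => len z),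
    (fun z => z.unpair.1 + z.unpair.2), (fun z => z.unpair.1 - z.unpair.2),
    (fun z => z.unpair.1 * z.unpair.2), (fun z => z.unpair.1 / z.unpair.2),
    (fun z => z.unpair.1 % z.unpair.2), (fun z => 2 ^ (len z.unpair.1 * len z.unpair.2)),
    (fun z => if z.unpair.1 = 0 then z.unpair.2.unpair.1 else z.unpair.2.unpair.2),
    (fun z => csize z), (fun z => cEval z.unpair.1 z.unpair.2),
    (fun z => (Nat.Partrec.Code.evaln (len z.unpair.1)
        (Denumerable.ofNat Nat.Partrec.Code z.unpair.2.unpair.1) z.unpair.2.unpair.2).getD 0)} :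
      Set (ℕ → ℕ)) ∪
  (Set.range (fun (c : ℕ) => (fun _ => c : ℕ → ℕ)) ∪
  (Set.range (fun (c : ℕ) => (fun z => 2 ^ (len z ^ c) : ℕ → ℕ)) ∪
   Set.range (fun (c : ℕ) => (fun z => z ^ c : ℕ → ℕ))))

def levSet : ℕ → Set (ℕ → ℕ)
  | 0 => baseSet
  | n + 1 => levSet n ∪ (Set.image2 (fun f g => (fun z => f (g z))) (levSet n) (levSet n) ∪
      (Set.image2 (fun f g => (fun z => Nat.pair (f z) (g z))) (levSet n) (levSet n) ∪
       Set.image2 (fun g (p : (ℕ → ℕ) × (ℕ → ℕ)) => (fun z => limRonF g p.1 p.2 z.unpair.1 z.unpair.2))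
        (levSet n) (levSet n ×ˢ levSet n)))

theorem levSet_countable (n : ℕ) : (levSet n).Countable := by
  induction n with
  | zero =>
    refine Set.Countable.union (Set.Finite.countable (Set.toFinite _)) ?_
    exact (Set.countable_range _).union ((Set.countable_range _).union (Set.countable_range _))
  | succ n ih =>
    exact ih.union ((ih.image2 ih _).union ((ih.image2 ih _).union (ih.image2 (ih.prod ih) _)))

theorem levSet_mono {m n : ℕ} (h : m ≤ n) : levSet m ⊆ levSet n := by
  induction n, h using Nat.le_induction with
  | base => exact le_rfl
  | succ n _ ih => exact ih.trans Set.subset_union_left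

theorem PTF.lev {f : ℕ → ℕ} (h : PTF f) : ∃ n, f ∈ levSet n := by
  induction h with
  | const c => exact ⟨0, Or.inr (Or.inl ⟨c, rfl⟩)⟩
  | unaryPow c => exact ⟨0, Or.inr (Or.inr (Or.inl ⟨c, rfl⟩))⟩
  | powc c => exact ⟨0, Or.inr (Or.inr (Or.inr ⟨c, rfl⟩))⟩
  | comp _ _ ih1 ih2 =>
    obtain ⟨n1, h1⟩ := ih1
    obtain ⟨n2, h2⟩ := ih2
    exact ⟨max n1 n2 + 1, Or.inr (Or.inl ⟨_, levSet_mono (le_max_left _ _) h1, _,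
      levSet_mono (le_max_right _ _) h2, rfl⟩)⟩
  | pairF _ _ ih1 ih2 =>
    obtain ⟨n1, h1⟩ := ih1
    obtain ⟨n2, h2⟩ := ih2
    exact ⟨max n1 n2 + 1, Or.inr (Or.inr (Or.inl ⟨_, levSet_mono (le_max_left _ _) h1, _,
      levSet_mono (le_max_right _ _) h2, rfl⟩))⟩
  | @limRon g h b _ _ _ ih1 ih2 ih3 =>
    obtain ⟨n1, h1⟩ := ih1
    obtain ⟨n2, h2⟩ := ih2
    obtain ⟨n3, h3⟩ := ih3
    exact ⟨max n1 (max n2 n3) + 1, Or.inr (Or.inr (Or.inr ⟨g, levSet_mono (by omega) h1, (h, b),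
      ⟨levSet_mono (by omega) h2, levSet_mono (by omega) h3⟩, rfl⟩))⟩
  | _ => exact ⟨0, Or.inl (by simp only [Set.mem_insert_iff, Set.mem_singleton_iff, true_or, or_true])⟩

theorem PTF.enum : ∃ e : ℕ → (ℕ → ℕ), (∀ n, PTF (e n)) ∧ ∀ f, PTF f → ∃ n, e n = f := by
  have hc : {f : ℕ → ℕ | PTF f}.Countable :=
    (Set.countable_iUnion levSet_countable).mono fun f hf => Set.mem_iUnion.2 (PTF.lev hf)
  obtain ⟨e, he⟩ := hc.exists_eq_range ⟨_, PTF.id'⟩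
  refine ⟨e, fun n => ?_, fun f hf => ?_⟩
  · have : e n ∈ {f : ℕ → ℕ | PTF f} := he ▸ Set.mem_range_self n
    exact this
  · have : f ∈ Set.range e := he ▸ hf
    exact this

/-! ### Histories -/

def hist (h : ℕ) (xs : ℕ → ℕ) : ℕ → ℕ
  | 0 => h
  | i + 1 => Nat.pair (hist h xs i) (xs i)

theorem hist_cons (h x : ℕ) (xs : ℕ → ℕ) (i : ℕ) :
    hist h (fun n => Nat.casesOn n x xs) (i + 1) = hist (Nat.pair h x) xs i := by
  induction i with
  | zero => rfl
  | succ i ih => rw [hist, ih]; rfl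

theorem not_win (k : ℕ) (g : ℕ → ℕ) (c : ℕ → ℕ → ℕ) (y r : ℕ) : ∀ s h,
    ¬ Win k g ((List.range' s r).map c) y h → ∃ xs : ℕ → ℕ, ∀ i < r,
      ¬ Good k g y (c (s + i) (hist h xs i)) (xs i) := by
  induction r with
  | zero => intro s h _; exact ⟨fun _ => 0, fun i hi => absurd hi (Nat.not_lt_zero _)⟩
  | succ r ih =>
    intro s h hw
    rw [List.range'_succ, List.map_cons, Win] at hw
    push Not at hw
    obtain ⟨x, h1, h2⟩ := hw
    obtain ⟨xs, hxs⟩ := ih (s + 1) _ h2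
    refine ⟨fun n => Nat.casesOn n x xs, fun i hi => ?_⟩
    cases i with
    | zero => exact h1
    | succ i =>
      rw [hist_cons]
      have := hxs i (by omega)
      rw [show s + 1 + i = s + (i + 1) by omega] at this
      exact this

theorem PTF.up1_iter (n : ℕ) : PTF (fun z => (fun w => (Nat.unpair w).1)^[n] z) := by
  induction n with
  | zero => exact PTF.id'
  | succ n ih => exact (ih.comp PTF.up1).congr fun z => by rw [Function.iterate_succ_apply]

theorem hist_back (h : ℕ) (xs : ℕ → ℕ) (i n : ℕ) :
    (fun w => (Nat.unpair w).1)^[n] (hist h xs (i + n)) = hist h xs i := by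
  induction n with
  | zero => rfl
  | succ n ih =>
    rw [Function.iterate_succ_apply, ← add_assoc, hist]
    simp only [Nat.unpair_pair]
    exact ih

theorem PTF.shift {f : ℕ → ℕ} (hf : PTF f) {i K : ℕ} (h : i ≤ K) : ∃ f', PTF f' ∧
    ∀ y xs, f' (hist y xs K) = f (hist y xs i) := by
  refine ⟨_, hf.comp (PTF.up1_iter (K - i)), fun y xs => ?_⟩
  have := hist_back y xs i (K - i)
  rw [show i + (K - i) = K by omega] at this
  simp only [this]

theorem PTF.vec (n : ℕ) : ∀ fs : Fin n → ℕ → ℕ, (∀ i, PTF (fs i)) →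
    ∃ e, PTF e ∧ ∀ z, decodeVec n (e z) = fun i => fs i z := by
  induction n with
  | zero => intro fs _; exact ⟨_, PTF.id', fun z => Subsingleton.elim _ _⟩
  | succ n ih =>
    intro fs h
    obtain ⟨e, he, h2⟩ := ih (fun i => fs i.succ) (fun i => h _)
    refine ⟨_, (h 0).pairF he, fun z => ?_⟩
    funext i
    refine Fin.cases ?_ (fun i => ?_) i
    · simp [decodeVec, argAt]
    · have := congrFun (h2 z) i
      simp only [decodeVec] at this
      simp [decodeVec, argAt, this]

/-! ### Universal sentences -/

theorem alls_universal (n : ℕ) : ∀ θ : BF n, θ.IsUniversal →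
    BoundedFormula.IsUniversal θ.alls := by
  induction n with
  | zero => intro θ h; exact h
  | succ n ih => intro θ h; exact ih _ h.all

instance True0_universal : Theory.IsUniversal True0 :=
  ⟨by
    rintro S ⟨⟨n, θ, hθ, rfl⟩, _⟩
    exact alls_universal n θ (BoundedFormula.IsUniversal.of_isQF hθ)⟩

end CLB


open FirstOrder FirstOrder.Language

namespace CLB

def fA : BF 3 := leF (ap1 lenSym (xv (0 : Fin 3))) (ap1 lenSym (xv (1 : Fin 3)))

def fB (k : ℕ) : BF 3 := leF (ap1 csizeSym (xv (2 : Fin 3))) (ap1 (powLenSym k) (xv (1 : Fin 3)))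

def fI (g : ℕ → ℕ) (hg : PTF g) : BF 4 :=
  (Term.bdEqual (ap1 lenSym (xv (3 : Fin 4))) (ap1 lenSym (xv (1 : Fin 4)))).imp
      (((atomicF (mkF1 g (hg.comp PTF.up1))).liftAt 3 0).iff
        (Term.bdEqual (ap2 cEvalSym (xv (2 : Fin 4)) (xv (3 : Fin 4))) oneT))

theorem isQF_fA : fA.IsQF := (BoundedFormula.IsAtomic.rel _ _).isQF

theorem isQF_fB (k : ℕ) : (fB k).IsQF := (BoundedFormula.IsAtomic.rel _ _).isQF

theorem isQF_fI (g : ℕ → ℕ) (hg : PTF g) : (fI g hg).IsQF := by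
  have h1 : ((atomicF (mkF1 g (hg.comp PTF.up1))).liftAt 3 0).IsQF :=
    ((BoundedFormula.IsAtomic.equal _ _).isQF).liftAt
  have h2 : (Term.bdEqual (ap2 cEvalSym (xv (2 : Fin 4)) (xv (3 : Fin 4))) oneT :
    BF 4).IsQF := (BoundedFormula.IsAtomic.equal _ _).isQF
  exact ((BoundedFormula.IsAtomic.equal _ _).isQF).imp ((h1.imp h2).inf (h2.imp h1))

theorem realize_fA (v : Empty → ℕ) (w : Fin 3 → ℕ) :
    fA.Realize v w ↔ len (w 0) ≤ len (w 1) := Iff.rfl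

theorem realize_fB (k : ℕ) (v : Empty → ℕ) (w : Fin 3 → ℕ) :
    (fB k).Realize v w ↔ csize (w 2) ≤ len (w 1) ^ k := Iff.rfl

theorem realize_fI (g : ℕ → ℕ) (hg : PTF g) (v : Empty → ℕ) (w : Fin 4 → ℕ) :
    (fI g hg).Realize v w ↔
      (len (w 3) = len (w 1) → (g (w 3) = 1 ↔ cEval (w 2) (w 3) = 1)) := by
  unfold fI
  rw [BoundedFormula.realize_imp, BoundedFormula.realize_iff]
  exact Iff.rfl

theorem UBio_realize (k : ℕ) (g : ℕ → ℕ) (hg : PTF g) (N : Type) [LPV.Structure N] :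
    N ⊨ UBio k (atomicF (mkF1 g (hg.comp PTF.up1))) ↔ ∀ y : N, ∃ z C : N,
      fA.Realize default (Fin.snoc (Fin.snoc (Fin.snoc default y) z) C : Fin 3 → N) ∧
      (fB k).Realize default (Fin.snoc (Fin.snoc (Fin.snoc default y) z) C : Fin 3 → N) ∧
      ∀ x : N, (fI g hg).Realize default
        (Fin.snoc (Fin.snoc (Fin.snoc (Fin.snoc default y) z) C : Fin 3 → N) x : Fin 4 → N) := by
  unfold UBio andF Sentence.Realize Formula.Realize
  simp only [BoundedFormula.realize_all, BoundedFormula.realize_ex, BoundedFormula.realize_not,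
    BoundedFormula.realize_imp, Classical.not_imp, not_not]
  exact Iff.rfl

theorem kpt (k : ℕ) (g : ℕ → ℕ) (hg : PTF g)
    (hp : Proves (PVT ∪ True0) (UBio k (atomicF (mkF1 g (hg.comp PTF.up1))))) :
    ∃ cs : List (ℕ → ℕ), (∀ c ∈ cs, PTF c) ∧ ∀ y, Win k g cs y y := by
  by_contra hcon
  push Not at hcon
  obtain ⟨e, he, hen⟩ := PTF.enum
  set c : ℕ → ℕ → ℕ := fun j z =>
    e j.unpair.1 ((fun w => (Nat.unpair w).1)^[j - j.unpair.2] z) with hcdef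
  have hc : ∀ j, PTF (c j) := fun j => (he _).comp (PTF.up1_iter _)
  have hr : ∀ r, ∃ (y : ℕ) (xs : ℕ → ℕ), ∀ i < r, ¬ Good k g y (c i (hist y xs i)) (xs i) := by
    intro r
    obtain ⟨y, hy⟩ := hcon ((List.range' 0 r).map c) (by
      intro f hf
      obtain ⟨j, _, rfl⟩ := List.mem_map.1 hf
      exact hc j)
    obtain ⟨xs, hxs⟩ := not_win k g c y r 0 y hy
    exact ⟨y, xs, fun i hi => by simpa using hxs i hi⟩
  choose y xs hbad using hr
  set h : ℕ → ℕ → ℕ := fun r i => hist (y r) (xs r) i with hh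
  let u : Ultrafilter ℕ := Filter.hyperfilter ℕ
  let M := (u : Filter ℕ).Product (fun _ : ℕ => ℕ)
  let G : (ℕ → ℕ) → M := fun f => (f : (u : Filter ℕ).Product (fun _ : ℕ => ℕ))
  let N : LPV.Substructure M :=
    { carrier := {p | ∃ f, PTF f ∧ ∃ i, p = G (fun r => f (h r i))}
      fun_mem := by
        intro n F ps hps
        choose f hf i hi using hps
        let K := Finset.univ.sup i
        have hK : ∀ j, i j ≤ K := fun j => Finset.le_sup (Finset.mem_univ j)
        choose f' hf' hs using fun j => PTF.shift (hf j) (hK j)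
        obtain ⟨w, hw, hw2⟩ := PTF.vec n f' hf'
        refine ⟨_, PTF.comp F.2 hw, K, ?_⟩
        have : ps = fun j => G (fun r => f j (h r (i j))) := funext hi
        rw [this]
        refine (Ultraproduct.funMap_cast F (fun j r => f j (h r (i j)))).trans ?_
        refine congrArg G (funext fun r => ?_)
        simp only [hw2]
        refine congrArg F.1 (funext fun j => ?_)
        exact (hs j _ _).symm }
  have hM : M ⊨ True0 := by
    refine ⟨fun S hS => ?_⟩
    exact (Ultraproduct.sentence_realize S).2 (Filter.Eventually.of_forall fun _ => hS.2)
  have hN : N ⊨ True0 := inferInstance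
  have hN' : N ⊨ PVT ∪ True0 := by
    rw [show PVT = True0 from rfl, Set.union_self]; exact hN
  have hne : Nonempty N := ⟨⟨G (fun r => h r 0), _, PTF.id', 0, rfl⟩⟩
  have hUB : N ⊨ UBio k (atomicF (mkF1 g (hg.comp PTF.up1))) := hp.realize_sentence N
  -- representatives
  have hrep : ∀ p : N, ∃ f : ℕ → ℕ, PTF f ∧ ∃ i, (p : M) = G (fun r => f (h r i)) := fun p => p.2
  choose f hf ix hfix using hrep
  let rep : N → ℕ → ℕ := fun p r => f p (h r (ix p))
  have hqf : ∀ {n : ℕ} (φ : BF n), φ.IsQF → ∀ ps : Fin n → N,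
      φ.Realize default ps → ∀ᶠ r in (u : Filter ℕ), φ.Realize (default : Empty → ℕ) (fun i => rep (ps i) r) := by
    intro n φ hφ ps hps
    have h1 := (hφ.realize_embedding N.subtype).2 hps
    have h2 : N.subtype ∘ ps = fun i => G (rep (ps i)) := funext fun i => hfix (ps i)
    rw [h2] at h1
    rw [Subsingleton.elim (N.subtype ∘ (default : Empty → N))
      (fun e : Empty => G ((fun e : Empty => e.elim) e))] at h1
    have h3 := (Ultraproduct.boundedFormula_realize_cast (u := u) (M := fun _ : ℕ => ℕ) φ
      (fun e : Empty => e.elim) (fun i => rep (ps i))).1 h1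
    refine h3.mono fun r hr => ?_
    rw [Subsingleton.elim (default : Empty → ℕ) (fun e : Empty => (e.elim : ℕ → ℕ) r)]
    exact hr
  -- evaluate the sentence
  let pY : N := ⟨G (fun r => h r 0), _, PTF.id', 0, rfl⟩
  obtain ⟨pZ, pC, hA, hB, hI⟩ := (UBio_realize k g hg N).1 hUB pY
  have hA' := hqf _ (isQF_fA) _ hA
  have hB' := hqf _ (isQF_fB k) _ hB
  have hY : ∀ᶠ r in (u : Filter ℕ), h r 0 = rep pY r :=
    Quotient.exact' (hfix pY)
  -- the move of the student
  let i := max (ix pZ) (ix pC)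
  obtain ⟨fz, hfz, sz⟩ := PTF.shift (hf pZ) (le_max_left (ix pZ) (ix pC))
  obtain ⟨fc, hfc, sc⟩ := PTF.shift (hf pC) (le_max_right (ix pZ) (ix pC))
  obtain ⟨a, ha⟩ := hen _ (hfz.pairF hfc)
  let j := Nat.pair a i
  have hcj : ∀ r, c j (h r j) = Nat.pair (rep pZ r) (rep pC r) := by
    intro r
    have hij : i ≤ j := Nat.right_le_pair a i
    have hb := hist_back (y r) (xs r) i (j - i)
    rw [show i + (j - i) = j by omega] at hb
    have e1 : j.unpair.1 = a := by simp [j]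
    have e2 : j.unpair.2 = i := by simp [j]
    simp only [hcdef, hh, e1, e2, ha, hb]
    exact congrArg₂ Nat.pair (sz _ _) (sc _ _)
  let pX : N := ⟨G (fun r => xs r j), _, PTF.up2, j + 1, congrArg G (funext fun r => by
    simp [hh, hist])⟩
  have hX : ∀ᶠ r in (u : Filter ℕ), xs r j = rep pX r :=
    Quotient.exact' (hfix pX)
  have hI' := hqf _ (isQF_fI g hg) _ (hI pX)
  have hlarge : ∀ᶠ r in (u : Filter ℕ), j < r := by
    have : ∀ᶠ r in Filter.cofinite, j < r := by
      rw [Nat.cofinite_eq_atTop]; exact Filter.eventually_gt_atTop j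
    exact Filter.hyperfilter_le_cofinite this
  obtain ⟨r, q1, q2, q3, q4, q5, q6⟩ :=
    (hA'.and (hB'.and (hI'.and (hY.and (hX.and hlarge))))).exists
  refine hbad r j q6 ?_
  have hcjr : c j (hist (y r) (xs r) j) = Nat.pair (rep pZ r) (rep pC r) := hcj r
  rw [hcjr]
  rw [realize_fA] at q1
  rw [realize_fB] at q2
  rw [realize_fI] at q3
  have hy0 : y r = rep pY r := q4
  rw [hy0, q5]
  unfold Good
  rw [Nat.unpair_pair]
  exact ⟨q1, q2, q3⟩

end CLB


namespace CLB

/-- **Theorem 1.1 (c).**  For every positive integer `k ≥ 1` there is an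
`L(PV)`-formula `φ(x)` — indeed an atomic formula `f(x) = 1` for a `PV` function
symbol `f` — defining a language in `P` such that the theory `PV ∪ True₀` does not
prove the sentence `UB^k_io(φ)`; i.e. it is consistent with `PV ∪ True₀` that
`P ⊄ i.o.SIZE[n^k]`. -/
theorem consistency_P_circuit_lower_bound (k : ℕ) (hk : 1 ≤ k) :
    ∃ f : LPV.Functions 1, LangOf (atomicF f) ∈ Pclass ∧
      ¬ Proves (PVT ∪ True0) (UBio k (atomicF f)) := by
  by_contra hcon
  push Not at hcon
  exact contra k fun g hg => kpt k g hg (hcon (mkF1 g (hg.comp PTF.up1)) ⟨g, hg, fun x => Iff.rfl⟩)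

end CLB
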